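/- There exists an infinite sequence of pairs (q_j, x_j) of positive integers and real numbers with q_j < x_j, with both q_j and x_j tending to infinity as j → ∞, such that G(x_j; q_j)/(x_j log q_j) → ∞ as j → ∞; moreover the same holds with V_Λ(x_j; q_j) in place of G(x_j; q_j). -/

import Mathlib

open Filter Real Complex
open scoped Classical

/-- `θ(x;q,a) = ∑_{p ≤ x, p ≡ a (mod q)} log p`. -/
noncomputable def thetaQA (x : ℝ) (q a : ℕ) : ℝ :=
  ∑ p ∈ (Finset.range (Nat.floor x + 1)).filter (fun p => p.Prime ∧ p % q = a), Real.log p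

/-- The variance `G(x;q)` of primes in arithmetic progressions mod `q`, weighted by `log p`. -/
noncomputable def Gvar (x : ℝ) (q : ℕ) : ℝ :=
  ∑ a ∈ (Finset.range q).filter (fun a => Nat.Coprime a q),
    (thetaQA x q a - x / (Nat.totient q)) ^ 2

/-- The variance `V_Λ(x;q)`. -/
noncomputable def Vvar (x : ℝ) (q : ℕ) : ℝ :=
  ∑ a ∈ (Finset.range q).filter (fun a => Nat.Coprime a q),
    ((∑ n ∈ (Finset.range (Nat.floor x + 1)).filter (fun n => n % q = a),
        ArithmeticFunction.vonMangoldt n)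
      - (1 / (Nat.totient q : ℝ)) *
        ∑ n ∈ (Finset.range (Nat.floor x + 1)).filter (fun n => Nat.Coprime n q),
          ArithmeticFunction.vonMangoldt n) ^ 2

open scoped Topology SchwartzMap FourierTransform
open MeasureTheory

/-- Simultaneous recurrence of finitely many characters of `ℝ`. -/
lemma exists_ge_norm_exp_sub_one_lt {n : ℕ} (γ : Fin n → ℝ) {ε : ℝ} (hε : 0 < ε) (X : ℝ) :
    ∃ U ≥ X, ∀ i, ‖Complex.exp (I * (γ i * U)) - 1‖ < ε := by
  set Y : ℝ := max X 1
  let v : ℕ → (Fin n → ℂ) := fun k i => Complex.exp (I * (γ i * (k * Y)))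
  have hv : ∀ k, v k ∈ Metric.closedBall (0 : Fin n → ℂ) 1 := by
    intro k
    rw [mem_closedBall_zero_iff, pi_norm_le_iff_of_nonneg zero_le_one]
    intro i
    have : I * ((γ i : ℂ) * (k * Y)) = ((γ i * (k * Y) : ℝ) : ℂ) * I := by push_cast; ring
    simp only [v]
    rw [this, norm_exp_ofReal_mul_I]
  obtain ⟨a, -, φ, hφ, ha⟩ := (isCompact_closedBall (0 : Fin n → ℂ) 1).tendsto_subseq hv
  obtain ⟨N, hN⟩ := (Metric.cauchySeq_iff.mp ha.cauchySeq) ε hε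
  have h1 := hN (N + 1) (by omega) N le_rfl
  have hlt : φ N < φ (N + 1) := hφ (Nat.lt_succ_self N)
  obtain ⟨d, hd⟩ := Nat.exists_eq_add_of_lt hlt
  refine ⟨((d + 1 : ℕ) : ℝ) * Y, ?_, ?_⟩
  · have hY : (1 : ℝ) ≤ Y := le_max_right _ _
    have : X ≤ Y := le_max_left _ _
    push_cast
    nlinarith [(Nat.cast_nonneg d : (0 : ℝ) ≤ d)]
  · intro i
    refine lt_of_eq_of_lt ?_ ((dist_le_pi_dist _ _ i).trans_lt h1)
    simp only [Function.comp, v, dist_eq_norm, hd]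
    have e1 : I * ((γ i : ℂ) * (((φ N + d + 1 : ℕ) : ℂ) * Y)) =
        I * (γ i * (((d + 1 : ℕ) : ℝ) * Y : ℝ)) + I * (γ i * ((φ N : ℂ) * Y)) := by
      push_cast; ring
    rw [e1, Complex.exp_add, ← sub_one_mul, norm_mul]
    have : I * ((γ i : ℂ) * (φ N * Y)) = ((γ i * (φ N * Y) : ℝ) : ℂ) * I := by push_cast; ring
    rw [this, norm_exp_ofReal_mul_I, mul_one]

/-- The modulus of a trigonometric polynomial at `0` is at most its limit superior at infinity. -/
lemma norm_sum_le_of_eventually_norm_sum_exp_le {n : ℕ} (γ : Fin n → ℝ) (c : Fin n → ℂ) (M : ℝ)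
    (h : ∀ ε > 0, ∀ᶠ U : ℝ in atTop, ‖∑ i, c i * Complex.exp (I * (γ i * U))‖ ≤ M + ε) :
    ‖∑ i, c i‖ ≤ M := by
  refine le_of_forall_pos_le_add fun ε hε => ?_
  obtain ⟨X, hX⟩ := eventually_atTop.mp (h (ε / 2) (half_pos hε))
  set S : ℝ := ∑ i, ‖c i‖ with hS
  have hS0 : 0 ≤ S := Finset.sum_nonneg fun i _ => norm_nonneg _
  obtain ⟨U, hU, hUi⟩ := exists_ge_norm_exp_sub_one_lt γ (ε := ε / (2 * (S + 1))) (by positivity) X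
  have h1 := hX U hU
  have h2 : ‖∑ i, c i - ∑ i, c i * Complex.exp (I * (γ i * U))‖ ≤ ε / 2 := by
    rw [← Finset.sum_sub_distrib]
    calc ‖∑ i, (c i - c i * Complex.exp (I * (γ i * U)))‖
        ≤ ∑ i, ‖c i‖ * (ε / (2 * (S + 1))) := by
          refine norm_sum_le_of_le _ fun i _ => ?_
          rw [← mul_one_sub, norm_mul, norm_sub_rev]
          gcongr
          exact (hUi i).le
      _ = S * (ε / (2 * (S + 1))) := by rw [← Finset.sum_mul]
      _ ≤ (S + 1) * (ε / (2 * (S + 1))) := by gcongr; linarith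
      _ = ε / 2 := by field_simp
  have := norm_le_norm_add_norm_sub' (∑ i, c i) (∑ i, c i * Complex.exp (I * (γ i * U)))
  linarith

/-- The Fourier transform in the normalisation `∫ k(t) e^{-itu} dt`. -/
noncomputable def angularFourier (k : 𝓢(ℝ, ℂ)) (u : ℝ) : ℂ := (𝓕 k) (u / (2 * π))

lemma angularFourier_eq (k : 𝓢(ℝ, ℂ)) (u : ℝ) :
    angularFourier k u = ∫ t : ℝ, k t * Complex.exp (-(I * (t * u))) := by
  rw [angularFourier, SchwartzMap.fourier_coe, Real.fourier_real_eq_integral_exp_smul]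
  refine integral_congr_ae (Eventually.of_forall fun t => ?_)
  simp only [smul_eq_mul]
  rw [mul_comm]
  congr 2
  have : (π : ℂ) ≠ 0 := by exact_mod_cast Real.pi_ne_zero
  push_cast
  field_simp

lemma continuous_angularFourier (k : 𝓢(ℝ, ℂ)) : Continuous (angularFourier k) :=
  (𝓕 k).continuous.comp (continuous_id.div_const _)

lemma integrable_angularFourier (k : 𝓢(ℝ, ℂ)) : Integrable (angularFourier k) :=
  (𝓕 k).integrable.comp_div (by positivity)

lemma integral_exp_mul_angularFourier (k : 𝓢(ℝ, ℂ)) (γ : ℝ) :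
    ∫ u : ℝ, Complex.exp (I * (γ * u)) * angularFourier k u = 2 * π * k γ := by
  have h0 : (π : ℂ) ≠ 0 := by exact_mod_cast Real.pi_ne_zero
  have h := congrArg (fun f : 𝓢(ℝ, ℂ) => f γ)
    (FourierTransform.fourierInv_fourier_eq (F := 𝓢(ℝ, ℂ)) k)
  simp only [SchwartzMap.fourierInv_coe, Real.fourierInv_eq'] at h
  have h1 := MeasureTheory.Measure.integral_comp_div
    (fun w : ℝ => Complex.exp (((2 * π * inner ℝ w γ : ℝ) : ℂ) * I) • (𝓕 k) w) (2 * π)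
  rw [h, abs_of_pos (by positivity)] at h1
  simp only [real_smul] at h1
  push_cast at h1
  rw [← h1]
  refine integral_congr_ae (Eventually.of_forall fun u => ?_)
  simp only [smul_eq_mul, angularFourier]
  congr 2
  simp
  field_simp

lemma integrable_laplace_kernel {φ : ℝ → ℂ} (hφ : Measurable φ) {C : ℝ} (hC : ∀ u > 0, ‖φ u‖ ≤ C)
    (k : 𝓢(ℝ, ℂ)) {δ : ℝ} (hδ : 0 < δ) (U : ℝ) :
    Integrable (Function.uncurry fun (t u : ℝ) =>
      φ u * Complex.exp (-((δ + t * I) * u)) * (k t * Complex.exp (I * (t * U))))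
      (volume.prod (volume.restrict (Set.Ioi (0 : ℝ)))) := by
  have h1 : Integrable (fun u : ℝ => C * Real.exp (-δ * u)) (volume.restrict (Set.Ioi (0 : ℝ))) :=
    (integrableOn_exp_mul_Ioi (by linarith) 0).const_mul C
  have h2 : Integrable (fun p : ℝ × ℝ => ‖k p.1‖ * (C * Real.exp (-δ * p.2)))
    (volume.prod (volume.restrict (Set.Ioi (0 : ℝ)))) := k.integrable.norm.mul_prod h1
  refine h2.mono' ?_ ?_
  · have hk : Measurable (k : ℝ → ℂ) := k.continuous.measurable
    apply Measurable.aestronglyMeasurable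
    simp only [Function.uncurry_def]
    fun_prop
  · have : ∀ᵐ p : ℝ × ℝ ∂(volume.prod (volume.restrict (Set.Ioi (0 : ℝ)))), p.2 ∈ Set.Ioi 0 :=
      (Measure.quasiMeasurePreserving_snd (μ := volume)
        (ν := volume.restrict (Set.Ioi (0 : ℝ)))).ae (ae_restrict_mem measurableSet_Ioi)
    filter_upwards [this] with p hp
    have e1 : ‖Complex.exp (I * ((p.1 : ℂ) * U))‖ = 1 := by
      rw [show I * ((p.1 : ℂ) * U) = ((p.1 * U : ℝ) : ℂ) * I by push_cast; ring,
        norm_exp_ofReal_mul_I]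
    have e2 : ‖Complex.exp (-((δ + p.1 * I) * (p.2 : ℂ)))‖ = Real.exp (-δ * p.2) := by
      rw [Complex.norm_exp]; simp
    simp only [Function.uncurry, norm_mul, e1, e2]
    rw [mul_one, mul_comm]
    gcongr
    exact hC _ hp

/-- Smoothing the Laplace transform of `φ` along a vertical line against a Schwartz function. -/
lemma integral_laplace_mul_eq {φ : ℝ → ℂ} (hφ : Measurable φ) {C : ℝ} (hC : ∀ u > 0, ‖φ u‖ ≤ C)
    (k : 𝓢(ℝ, ℂ)) {δ : ℝ} (hδ : 0 < δ) (U : ℝ) :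
    ∫ t : ℝ, (∫ u in Set.Ioi (0 : ℝ), φ u * Complex.exp (-((δ + t * I) * u))) *
        (k t * Complex.exp (I * (t * U))) =
      ∫ u in Set.Ioi (0 : ℝ), φ u * Complex.exp (-(δ * u)) * angularFourier k (u - U) := by
  simp_rw [← integral_mul_const]
  rw [integral_integral_swap (integrable_laplace_kernel hφ hC k hδ U)]
  refine integral_congr_ae (Eventually.of_forall fun u => ?_)
  simp only
  rw [angularFourier_eq, ← integral_const_mul]
  refine integral_congr_ae (Eventually.of_forall fun t => ?_)
  simp only
  have : Complex.exp (-((δ + t * I) * (u : ℂ))) * Complex.exp (I * (t * U)) =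
      Complex.exp (-(δ * u)) * Complex.exp (-(I * (t * ((u - U : ℝ) : ℂ)))) := by
    rw [← Complex.exp_add, ← Complex.exp_add]
    congr 1
    push_cast
    ring
  linear_combination (φ u * k t) * this

lemma norm_setIntegral_mul_angularFourier_le {φ : ℝ → ℂ} {C : ℝ} (hC : ∀ u > 0, ‖φ u‖ ≤ C)
    (k : 𝓢(ℝ, ℂ)) (U : ℝ) :
    ‖∫ u in Set.Ioi (0 : ℝ), φ u * angularFourier k (u - U)‖ ≤
      C * ∫ u, ‖angularFourier k u‖ := by
  have hC0 : 0 ≤ C := (norm_nonneg _).trans (hC 1 one_pos)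
  have hi : Integrable fun u : ℝ => C * ‖angularFourier k (u - U)‖ :=
    ((integrable_angularFourier k).comp_sub_right U).norm.const_mul C
  calc ‖∫ u in Set.Ioi (0 : ℝ), φ u * angularFourier k (u - U)‖
      ≤ ∫ u in Set.Ioi (0 : ℝ), C * ‖angularFourier k (u - U)‖ := by
        refine norm_integral_le_of_norm_le hi.integrableOn ?_
        filter_upwards [ae_restrict_mem measurableSet_Ioi] with u hu
        rw [norm_mul]
        gcongr
        exact hC u hu
    _ ≤ ∫ u, C * ‖angularFourier k (u - U)‖ :=
        setIntegral_le_integral hi (Eventually.of_forall fun u => by positivity)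
    _ = C * ∫ u, ‖angularFourier k u‖ := by
        rw [integral_const_mul, integral_sub_right_eq_self fun u => ‖angularFourier k u‖]

/-- Integrals along vertical segments of a function continuous on a rectangle converge to the
integral along its left side. -/
lemma tendsto_integral_vertical {R : ℂ → ℂ} {δ₀ T : ℝ} (hδ₀ : 0 < δ₀)
    (hR : ContinuousOn R (Set.Icc 0 δ₀ ×ℂ Set.Icc (-T) T)) {g : ℝ → ℂ} (hg : Continuous g)
    (hgT : ∀ t, T < |t| → g t = 0) :
    (∀ δ ∈ Set.Icc 0 δ₀, Integrable fun t : ℝ => R (δ + t * I) * g t) ∧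
      Tendsto (fun δ : ℝ => ∫ t : ℝ, R (δ + t * I) * g t) (𝓝[>] 0)
        (𝓝 (∫ t : ℝ, R (t * I) * g t)) := by
  have hcomp : IsCompact (Set.Icc 0 δ₀ ×ℂ Set.Icc (-T) T) := isCompact_Icc.reProdIm isCompact_Icc
  obtain ⟨M, hM⟩ := hcomp.exists_bound_of_continuousOn hR
  have hgc : HasCompactSupport g := HasCompactSupport.intro (K := Set.Icc (-T) T) isCompact_Icc
    fun t ht => hgT t (not_le.mp fun h => ht (abs_le.mp h))
  have hmem : ∀ δ t : ℝ, δ ∈ Set.Icc 0 δ₀ → |t| ≤ T →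
      (δ + t * I : ℂ) ∈ Set.Icc 0 δ₀ ×ℂ Set.Icc (-T) T := by
    intro δ t hδ ht
    simpa [mem_reProdIm] using ⟨hδ, abs_le.mp ht⟩
  have hδev : ∀ᶠ δ : ℝ in 𝓝[>] 0, δ ∈ Set.Ioc 0 δ₀ := Ioc_mem_nhdsGT hδ₀
  have hline : ∀ δ ∈ Set.Icc 0 δ₀, Integrable fun t : ℝ => R (δ + t * I) * g t := by
    intro δ hδ
    have e : (fun t : ℝ => R (δ + t * I) * g t) =
        (Set.Icc (-T) T).indicator fun t : ℝ => R (δ + t * I) * g t := by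
      funext t
      by_cases ht : t ∈ Set.Icc (-T) T
      · rw [Set.indicator_of_mem ht]
      · rw [Set.indicator_of_notMem ht, hgT t (not_le.mp fun h => ht (abs_le.mp h)), mul_zero]
    rw [e, integrable_indicator_iff measurableSet_Icc]
    refine ContinuousOn.integrableOn_Icc (ContinuousOn.mul ?_ hg.continuousOn)
    exact hR.comp (by fun_prop) fun t ht => hmem δ t hδ (abs_le.mpr ht)
  refine ⟨hline, tendsto_integral_filter_of_dominated_convergence (fun t => M * ‖g t‖) ?_ ?_
    ((hg.integrable_of_hasCompactSupport hgc).norm.const_mul M) ?_⟩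
  · filter_upwards [hδev] with δ hδ
    exact (hline δ ⟨hδ.1.le, hδ.2⟩).aestronglyMeasurable
  · filter_upwards [hδev] with δ hδ
    refine Eventually.of_forall fun t => ?_
    rcases le_or_gt |t| T with ht | ht
    · rw [norm_mul]
      gcongr
      exact hM _ (hmem δ t ⟨hδ.1.le, hδ.2⟩ ht)
    · simp [hgT t ht]
  · refine Eventually.of_forall fun t => ?_
    rcases le_or_gt |t| T with ht | ht
    · refine Tendsto.mul_const _ ?_
      have h0 := hR (t * I) (by simpa using hmem 0 t ⟨le_rfl, hδ₀.le⟩ ht)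
      refine h0.tendsto.comp (tendsto_nhdsWithin_iff.mpr ⟨?_, ?_⟩)
      · have : Tendsto (fun δ : ℝ => (δ : ℂ) + t * I) (𝓝 0) (𝓝 ((0 : ℝ) + t * I)) :=
          Continuous.tendsto (by fun_prop) 0
        simpa using this.mono_left nhdsWithin_le_nhds
      · filter_upwards [hδev] with δ hδ
        exact hmem δ t ⟨hδ.1.le, hδ.2⟩ ht
    · simp [hgT t ht]

/-- Letting the vertical line tend to the imaginary axis in `integral_laplace_mul_eq`, when the
Laplace transform extends continuously to the boundary segment carrying `k`. -/
lemma integral_boundary_mul_eq {φ : ℝ → ℂ} (hφ : Measurable φ) {C : ℝ}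
    (hC : ∀ u > 0, ‖φ u‖ ≤ C) (k : 𝓢(ℝ, ℂ)) {T : ℝ} (hk : ∀ t, T < |t| → k t = 0) {R : ℂ → ℂ}
    {δ₀ : ℝ} (hδ₀ : 0 < δ₀) (hR : ContinuousOn R (Set.Icc 0 δ₀ ×ℂ Set.Icc (-T) T))
    (hH : ∀ z ∈ Set.Ioc 0 δ₀ ×ℂ Set.Icc (-T) T,
      ∫ u in Set.Ioi (0 : ℝ), φ u * Complex.exp (-(z * u)) = R z) (U : ℝ) :
    ∫ t : ℝ, R (t * I) * (k t * Complex.exp (I * (t * U))) =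
      ∫ u in Set.Ioi (0 : ℝ), φ u * angularFourier k (u - U) := by
  have hC0 : 0 ≤ C := (norm_nonneg _).trans (hC 1 one_pos)
  have hδev : ∀ᶠ δ : ℝ in 𝓝[>] 0, δ ∈ Set.Ioc 0 δ₀ := Ioc_mem_nhdsGT hδ₀
  have hL := (tendsto_integral_vertical hδ₀ hR
    (g := fun t : ℝ => k t * Complex.exp (I * (t * U))) (k.continuous.mul (by fun_prop))
    fun t ht => by rw [hk t ht, zero_mul]).2
  have hRt : Tendsto (fun δ : ℝ => ∫ u in Set.Ioi (0 : ℝ),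
      φ u * Complex.exp (-(δ * u)) * angularFourier k (u - U)) (𝓝[>] 0)
      (𝓝 (∫ u in Set.Ioi (0 : ℝ), φ u * angularFourier k (u - U))) := by
    have hK := (continuous_angularFourier k).measurable
    refine tendsto_integral_filter_of_dominated_convergence
      (fun u => C * ‖angularFourier k (u - U)‖) ?_ ?_
      (((integrable_angularFourier k).comp_sub_right U).norm.const_mul C).integrableOn ?_
    · refine Eventually.of_forall fun δ => Measurable.aestronglyMeasurable ?_
      fun_prop
    · filter_upwards [hδev] with δ hδ
      filter_upwards [ae_restrict_mem measurableSet_Ioi] with u hu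
      rw [norm_mul, norm_mul]
      gcongr
      calc ‖φ u‖ * ‖Complex.exp (-(δ * u))‖ ≤ C * 1 := by
            gcongr
            · exact hC u hu
            · rw [Complex.norm_exp]
              simpa using mul_nonneg hδ.1.le (le_of_lt hu)
        _ = C := mul_one C
    · refine Eventually.of_forall fun u => Tendsto.mul_const _ ?_
      have : Tendsto (fun δ : ℝ => φ u * Complex.exp (-(δ * u))) (𝓝 0)
          (𝓝 (φ u * Complex.exp (-((0 : ℝ) * u)))) := Continuous.tendsto (by fun_prop) 0
      simpa using this.mono_left nhdsWithin_le_nhds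
  refine tendsto_nhds_unique hL (hRt.congr' ?_)
  filter_upwards [hδev] with δ hδ
  rw [← integral_laplace_mul_eq hφ hC k hδ.1 U]
  refine integral_congr_ae (Eventually.of_forall fun t => ?_)
  rcases le_or_gt |t| T with ht | ht
  · simp only
    rw [hH]
    simpa [mem_reProdIm] using ⟨hδ, abs_le.mp ht⟩
  · simp [hk t ht]

/-- If a bounded function has a Laplace transform whose only singularities on a boundary segment are
simple poles, then the residues, weighted by a test function carried by that segment, are controlled
by the `L¹` norm of the Fourier transform of the test function. -/
lemma norm_sum_residues_mul_le {f : ℝ → ℂ} (hf : Measurable f) {C : ℝ}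
    (hC : ∀ u > 0, ‖f u‖ ≤ C) (k : 𝓢(ℝ, ℂ)) {T : ℝ} (hk : ∀ t, T < |t| → k t = 0) {n : ℕ}
    (γ : Fin n → ℝ) (c : Fin n → ℂ) {R : ℂ → ℂ}
    {δ₀ : ℝ} (hδ₀ : 0 < δ₀) (hR : ContinuousOn R (Set.Icc 0 δ₀ ×ℂ Set.Icc (-T) T))
    (hH : ∀ z ∈ Set.Ioc 0 δ₀ ×ℂ Set.Icc (-T) T,
      ∫ u in Set.Ioi (0 : ℝ), f u * Complex.exp (-(z * u)) =
        ∑ i, c i / (z - γ i * I) + R z) :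
    2 * π * ‖∑ i, c i * k (γ i)‖ ≤ C * ∫ u, ‖angularFourier k u‖ := by
  set φ : ℝ → ℂ := fun u => f u - ∑ i, c i * Complex.exp (I * (γ i * u)) with hφdef
  have hnI : ∀ t U : ℝ, ‖Complex.exp (I * ((t : ℂ) * U))‖ = 1 := fun t U => by
    rw [show I * ((t : ℂ) * U) = ((t * U : ℝ) : ℂ) * I by push_cast; ring, norm_exp_ofReal_mul_I]
  have hφ : Measurable φ := by fun_prop
  have hφC : ∀ u > 0, ‖φ u‖ ≤ C + ∑ i, ‖c i‖ := by
    intro u hu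
    refine (norm_sub_le _ _).trans (add_le_add (hC u hu) (norm_sum_le_of_le _ fun i _ => ?_))
    rw [norm_mul, hnI, mul_one]
  have hexp : ∀ (i : Fin n) (z : ℂ), 0 < z.re → IntegrableOn
      (fun u : ℝ => c i * Complex.exp (I * (γ i * u)) * Complex.exp (-(z * u))) (Set.Ioi 0) ∧
      ∫ u in Set.Ioi (0 : ℝ), c i * Complex.exp (I * (γ i * u)) * Complex.exp (-(z * u)) =
        c i / (z - γ i * I) := by
    intro i z hz
    have hre : (γ i * I - z).re < 0 := by simpa using hz
    have e : (fun u : ℝ => c i * Complex.exp (I * (γ i * u)) * Complex.exp (-(z * u))) =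
        fun u : ℝ => c i * Complex.exp ((γ i * I - z) * u) := by
      funext u
      rw [mul_assoc, ← Complex.exp_add]
      ring_nf
    rw [e]
    refine ⟨(integrableOn_exp_mul_complex_Ioi hre 0).const_mul _, ?_⟩
    rw [integral_const_mul, integral_exp_mul_complex_Ioi hre]
    have h0 : (γ i * I - z) ≠ 0 := fun h => by rw [h] at hre; simp at hre
    have h1 : (z - γ i * I) ≠ 0 := fun h => h0 (by rw [← neg_sub, h, neg_zero])
    field_simp
    simp
    ring
  have hHφ : ∀ z ∈ Set.Ioc 0 δ₀ ×ℂ Set.Icc (-T) T,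
      ∫ u in Set.Ioi (0 : ℝ), φ u * Complex.exp (-(z * u)) = R z := by
    intro z hz
    have hz0 : 0 < z.re := hz.1.1
    have hfi : IntegrableOn (fun u : ℝ => f u * Complex.exp (-(z * u))) (Set.Ioi 0) := by
      have h1 : IntegrableOn (fun u : ℝ => C * Real.exp (-z.re * u)) (Set.Ioi (0 : ℝ)) :=
        (integrableOn_exp_mul_Ioi (by linarith) 0).const_mul C
      refine Integrable.mono' h1 (Measurable.aestronglyMeasurable (by fun_prop)) ?_
      filter_upwards [ae_restrict_mem measurableSet_Ioi] with u hu
      rw [norm_mul, Complex.norm_exp]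
      simp only [neg_re, re_mul_ofReal, neg_mul]
      gcongr
      exact hC u hu
    have e : (fun u : ℝ => φ u * Complex.exp (-(z * u))) = fun u : ℝ =>
        f u * Complex.exp (-(z * u)) -
          ∑ i, c i * Complex.exp (I * (γ i * u)) * Complex.exp (-(z * u)) := by
      funext u
      simp only [hφdef, sub_mul, Finset.sum_mul]
    rw [e, integral_sub hfi (integrable_finsetSum _ fun i _ => (hexp i z hz0).1),
      integral_finsetSum _ fun i _ => (hexp i z hz0).1, hH z hz]
    simp only [(hexp _ z hz0).2]
    ring
  have hbd := integral_boundary_mul_eq hφ hφC k hk hδ₀ hR hHφ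
  have hRL : Tendsto (fun U : ℝ => ∫ u in Set.Ioi (0 : ℝ), φ u * angularFourier k (u - U)) atTop
      (𝓝 0) := by
    simp_rw [← hbd]
    have h1 := (Real.zero_at_infty_fourier fun t : ℝ => R (t * I) * k t).mono_left
      atBot_le_cocompact
    have h2 : Tendsto (fun U : ℝ => -U / (2 * π)) atTop atBot :=
      tendsto_neg_atTop_atBot.atBot_div_const (by positivity)
    refine (h1.comp h2).congr fun U => ?_
    simp only [Function.comp, Real.fourier_real_eq_integral_exp_smul]
    refine integral_congr_ae (Eventually.of_forall fun t => ?_)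
    have hpi : (π : ℂ) ≠ 0 := by exact_mod_cast Real.pi_ne_zero
    have : ((-2 * π * t * (-U / (2 * π)) : ℝ) : ℂ) * I = I * (t * U) := by
      push_cast
      field_simp
    simp only [this, smul_eq_mul]
    ring
  have htail : ∀ g : ℝ, Tendsto (fun U : ℝ => (∫ u in Set.Ioi (0 : ℝ),
      Complex.exp (I * (g * u)) * angularFourier k (u - U)) -
      2 * π * k g * Complex.exp (I * (g * U))) atTop (𝓝 0) := by
    intro g
    have hgi : Integrable fun u : ℝ => Complex.exp (I * (g * u)) * angularFourier k u := by
      refine (integrable_angularFourier k).norm.mono' ?_ (Eventually.of_forall fun u => ?_)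
      · exact Continuous.aestronglyMeasurable
          ((by fun_prop : Continuous fun u : ℝ => Complex.exp (I * (g * u))).mul
            (continuous_angularFourier k))
      · rw [norm_mul, hnI, one_mul]
    have h1 : ∀ U : ℝ, ∫ u in Set.Ioi (0 : ℝ),
        Complex.exp (I * (g * u)) * angularFourier k (u - U) = Complex.exp (I * (g * U)) *
          ∫ u in Set.Ioi (-U), Complex.exp (I * (g * u)) * angularFourier k u := by
      intro U
      rw [← integral_const_mul, ← integral_indicator measurableSet_Ioi,
        ← integral_indicator measurableSet_Ioi,
        ← integral_sub_right_eq_self ((Set.Ioi (-U)).indicator _) U]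
      refine integral_congr_ae (Eventually.of_forall fun u => ?_)
      simp only
      have hexp' : Complex.exp (I * (g * u)) =
          Complex.exp (I * (g * U)) * Complex.exp (I * (g * ((u - U : ℝ) : ℂ))) := by
        rw [← Complex.exp_add]
        push_cast
        ring_nf
      by_cases hu : 0 < u
      · rw [Set.indicator_of_mem (Set.mem_Ioi.mpr hu),
          Set.indicator_of_mem (Set.mem_Ioi.mpr (by linarith)), hexp', mul_assoc]
      · rw [Set.indicator_of_notMem (by simpa using hu),
          Set.indicator_of_notMem (by simpa using hu)]
    have h2 : Tendsto (fun U : ℝ => ∫ u in Set.Ioi (-U),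
        Complex.exp (I * (g * u)) * angularFourier k u) atTop (𝓝 (2 * π * k g)) := by
      rw [← integral_exp_mul_angularFourier]
      exact (aecover_Ioi tendsto_neg_atTop_atBot).integral_tendsto_of_countably_generated hgi
    have h3 : Tendsto (fun U : ℝ => (∫ u in Set.Ioi (-U),
        Complex.exp (I * (g * u)) * angularFourier k u) - 2 * π * k g) atTop (𝓝 0) := by
      simpa using h2.sub_const (2 * π * k g)
    rw [tendsto_zero_iff_norm_tendsto_zero] at h3 ⊢
    refine h3.congr fun U => ?_
    rw [h1, show ∀ a b c : ℂ, a * b - c * a = a * (b - c) from fun a b c => by ring, norm_mul, hnI,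
      one_mul]
  have hdiff : Tendsto (fun U : ℝ => (∫ u in Set.Ioi (0 : ℝ), f u * angularFourier k (u - U)) -
      2 * π * ∑ i, c i * k (γ i) * Complex.exp (I * (γ i * U))) atTop (𝓝 0) := by
    have h1 := hRL.add (tendsto_finsetSum Finset.univ fun i _ => (htail (γ i)).const_mul (c i))
    simp only [mul_zero, Finset.sum_const_zero, add_zero] at h1
    refine h1.congr fun U => ?_
    have hKi := (integrable_angularFourier k).comp_sub_right U
    have hfi : IntegrableOn (fun u => f u * angularFourier k (u - U)) (Set.Ioi 0) := by
      refine (hKi.norm.const_mul C).integrableOn.mono' (Measurable.aestronglyMeasurable ?_) ?_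
      · have := (continuous_angularFourier k).measurable
        fun_prop
      · filter_upwards [ae_restrict_mem measurableSet_Ioi] with u hu
        rw [norm_mul]
        gcongr
        exact hC u hu
    have hei : ∀ i, IntegrableOn (fun u : ℝ => c i * (Complex.exp (I * (γ i * u)) *
        angularFourier k (u - U))) (Set.Ioi 0) := by
      intro i
      refine Integrable.const_mul (hKi.norm.integrableOn.mono'
        (Continuous.aestronglyMeasurable ?_) (Eventually.of_forall fun u => ?_)) _
      · have := continuous_angularFourier k
        fun_prop
      · rw [norm_mul, hnI, one_mul]
    have e : (fun u : ℝ => φ u * angularFourier k (u - U)) = fun u : ℝ =>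
        f u * angularFourier k (u - U) -
          ∑ i, c i * (Complex.exp (I * (γ i * u)) * angularFourier k (u - U)) := by
      funext u
      simp only [hφdef, sub_mul, Finset.sum_mul, mul_assoc]
    rw [e, integral_sub hfi (integrable_finsetSum _ fun i _ => hei i),
      integral_finsetSum _ fun i _ => hei i]
    simp only [integral_const_mul, mul_sub, Finset.sum_sub_distrib, Finset.mul_sum]
    have : ∀ i, c i * (2 * π * k (γ i) * Complex.exp (I * (γ i * U))) =
        2 * π * (c i * k (γ i) * Complex.exp (I * (γ i * U))) := fun i => by ring
    simp only [this]
    ring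
  have hfin := norm_sum_le_of_eventually_norm_sum_exp_le γ (fun i => 2 * π * (c i * k (γ i)))
    (C * ∫ u, ‖angularFourier k u‖) fun ε hε => by
      filter_upwards [hdiff.norm.eventually_lt_const (by simpa using hε)] with U hU
      have h1 := norm_setIntegral_mul_angularFourier_le hC k U
      have h2 : ∑ i, 2 * π * (c i * k (γ i)) * Complex.exp (I * (γ i * U)) =
          2 * π * ∑ i, c i * k (γ i) * Complex.exp (I * (γ i * U)) := by
        rw [Finset.mul_sum]
        exact Finset.sum_congr rfl fun i _ => by ring
      rw [h2]
      have h3 := norm_le_norm_add_norm_sub (∫ u in Set.Ioi (0 : ℝ), f u * angularFourier k (u - U))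
        (2 * π * ∑ i, c i * k (γ i) * Complex.exp (I * (γ i * U)))
      linarith
  rw [← Finset.mul_sum, norm_mul] at hfin
  simpa [abs_of_pos Real.pi_pos] using hfin

lemma tendsto_integral_poisson {g : ℝ → ℂ} (hg : Continuous g) {M : ℝ} (hM : ∀ t, ‖g t‖ ≤ M)
    (γ : ℝ) :
    Tendsto (fun δ : ℝ => ∫ t : ℝ, ((2 * δ / (δ ^ 2 + (t - γ) ^ 2) : ℝ) : ℂ) * g t) (𝓝[>] 0)
      (𝓝 (2 * π * g γ)) := by
  have hlim : Tendsto (fun δ : ℝ => ∫ v : ℝ, ((2 / (1 + v ^ 2) : ℝ) : ℂ) * g (γ + δ * v)) (𝓝[>] 0)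
      (𝓝 (∫ v : ℝ, ((2 / (1 + v ^ 2) : ℝ) : ℂ) * g γ)) := by
    have hi : Integrable fun v : ℝ => 2 / (1 + v ^ 2) := by
      simpa [div_eq_mul_inv] using integrable_inv_one_add_sq.const_mul 2
    refine tendsto_integral_filter_of_dominated_convergence (fun v => 2 / (1 + v ^ 2) * M) ?_ ?_
      (hi.mul_const M) ?_
    · refine Eventually.of_forall fun δ => Measurable.aestronglyMeasurable ?_
      have := hg.measurable
      fun_prop
    · refine Eventually.of_forall fun δ => Eventually.of_forall fun v => ?_
      rw [norm_mul, Complex.norm_real, Real.norm_of_nonneg (by positivity)]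
      gcongr
      exact hM _
    · refine Eventually.of_forall fun v => Tendsto.const_mul _ ?_
      have : Tendsto (fun δ : ℝ => g (γ + δ * v)) (𝓝 0) (𝓝 (g (γ + 0 * v))) :=
        Continuous.tendsto (by fun_prop) 0
      simpa using this.mono_left nhdsWithin_le_nhds
  have hval : ∫ v : ℝ, ((2 / (1 + v ^ 2) : ℝ) : ℂ) * g γ = 2 * π * g γ := by
    rw [integral_mul_const, integral_complex_ofReal]
    simp only [div_eq_mul_inv, integral_const_mul, integral_univ_inv_one_add_sq]
    push_cast
    ring
  rw [hval] at hlim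
  refine hlim.congr' ?_
  filter_upwards [self_mem_nhdsWithin] with δ hδ
  have hδ : 0 < δ := hδ
  have h1 := integral_add_left_eq_self (μ := volume)
    (fun t : ℝ => ((2 * δ / (δ ^ 2 + (t - γ) ^ 2) : ℝ) : ℂ) * g t) γ
  have h2 := MeasureTheory.Measure.integral_comp_mul_left
    (fun t : ℝ => ((2 * δ / (δ ^ 2 + (γ + t - γ) ^ 2) : ℝ) : ℂ) * g (γ + t)) δ
  rw [h1, abs_of_pos (inv_pos.mpr hδ), real_smul] at h2
  have h3 : (δ : ℂ) ≠ 0 := by exact_mod_cast hδ.ne'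
  have h4 : ∫ t : ℝ, ((2 * δ / (δ ^ 2 + (t - γ) ^ 2) : ℝ) : ℂ) * g t = δ * ∫ x : ℝ,
      ((2 * δ / (δ ^ 2 + (γ + δ * x - γ) ^ 2) : ℝ) : ℂ) * g (γ + δ * x) := by
    rw [h2]
    push_cast
    field_simp
  rw [h4, ← integral_const_mul]
  refine integral_congr_ae (Eventually.of_forall fun v => ?_)
  simp only
  rw [← mul_assoc, ← Complex.ofReal_mul]
  congr 2
  have : γ + δ * v - γ = δ * v := by ring
  rw [this]
  field_simp

/-- The boundary values of an odd function with simple poles of residue one on the imaginary axis,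
tested against an even function, see only the poles. -/
lemma tendsto_integral_of_odd {n : ℕ} (γ : Fin n → ℝ) {q D : ℂ → ℂ} {δ₀ T : ℝ} (hδ₀ : 0 < δ₀)
    (hq : ContinuousOn q (Set.Icc (-δ₀) δ₀ ×ℂ Set.Icc (-T) T))
    (hD : ∀ z ∈ Set.Icc (-δ₀) δ₀ ×ℂ Set.Icc (-T) T, z.re ≠ 0 →
      D z = ∑ i, 1 / (z - γ i * I) + q z)
    (hodd : ∀ z, D (-z) = -D z) {g : ℝ → ℂ} (hg : Continuous g) (heven : ∀ t, g (-t) = g t)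
    (hgT : ∀ t, T < |t| → g t = 0) :
    Tendsto (fun δ : ℝ => ∫ t : ℝ, D (δ + t * I) * g t) (𝓝[>] 0) (𝓝 (π * ∑ i, g (γ i))) := by
  have hgc : HasCompactSupport g := HasCompactSupport.intro (K := Set.Icc (-T) T) isCompact_Icc
    fun t ht => hgT t (not_le.mp fun h => ht (abs_le.mp h))
  obtain ⟨Mg, hMg⟩ := hg.bounded_above_of_compact_support hgc
  have hcomp : IsCompact (Set.Icc (-δ₀) δ₀ ×ℂ Set.Icc (-T) T) :=
    isCompact_Icc.reProdIm isCompact_Icc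
  obtain ⟨M, hM⟩ := hcomp.exists_bound_of_continuousOn hq
  have hmem : ∀ δ t : ℝ, |δ| ≤ δ₀ → |t| ≤ T →
      (δ + t * I : ℂ) ∈ Set.Icc (-δ₀) δ₀ ×ℂ Set.Icc (-T) T := by
    intro δ t hδ ht
    simpa [mem_reProdIm] using ⟨abs_le.mp hδ, abs_le.mp ht⟩
  have hqint : ∀ δ : ℝ, |δ| ≤ δ₀ → Integrable fun t : ℝ => q (δ + t * I) * g t := by
    intro δ hδ
    have e : (fun t : ℝ => q (δ + t * I) * g t) =
        (Set.Icc (-T) T).indicator fun t : ℝ => q (δ + t * I) * g t := by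
      funext t
      by_cases ht : t ∈ Set.Icc (-T) T
      · rw [Set.indicator_of_mem ht]
      · rw [Set.indicator_of_notMem ht, hgT t (not_le.mp fun h => ht (abs_le.mp h)), mul_zero]
    rw [e, integrable_indicator_iff measurableSet_Icc]
    refine ContinuousOn.integrableOn_Icc (ContinuousOn.mul ?_ hg.continuousOn)
    exact hq.comp (by fun_prop) fun t ht => hmem δ t hδ (abs_le.mpr ht)
  have hpint : ∀ (δ : ℝ) (i : Fin n), δ ≠ 0 →
      Integrable fun t : ℝ => 1 / (δ + t * I - γ i * I) * g t := by
    intro δ i hδ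
    have h0 : ∀ t : ℝ, (δ + t * I - γ i * I : ℂ) ≠ 0 := fun t h =>
      hδ (by simpa using congrArg Complex.re h)
    refine Continuous.integrable_of_hasCompactSupport ?_ hgc.mul_left
    exact (continuous_const.div (by fun_prop) h0).mul hg
  have hDint : ∀ δ : ℝ, δ ≠ 0 → |δ| ≤ δ₀ → ∫ t : ℝ, D (δ + t * I) * g t =
      ∑ i, (∫ t : ℝ, 1 / (δ + t * I - γ i * I) * g t) + ∫ t : ℝ, q (δ + t * I) * g t := by
    intro δ hδ hδ'
    rw [← integral_finsetSum _ fun i _ => hpint δ i hδ,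
      ← integral_add (integrable_finsetSum _ fun i _ => hpint δ i hδ) (hqint δ hδ')]
    refine integral_congr_ae (Eventually.of_forall fun t => ?_)
    rcases le_or_gt |t| T with ht | ht
    · simp only
      rw [hD _ (hmem δ t hδ' ht) (by simpa using hδ), add_mul, Finset.sum_mul]
    · simp [hgT t ht]
  have hneg : ∀ δ : ℝ, ∫ t : ℝ, D ((-δ : ℝ) + t * I) * g t = -∫ t : ℝ, D (δ + t * I) * g t := by
    intro δ
    rw [← integral_neg_eq_self, ← integral_neg]
    refine integral_congr_ae (Eventually.of_forall fun t => ?_)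
    simp only
    rw [heven, ← neg_mul, ← hodd]
    congr 2
    push_cast
    ring
  have hδev : ∀ᶠ δ : ℝ in 𝓝[>] 0, δ ∈ Set.Ioc 0 δ₀ := Ioc_mem_nhdsGT hδ₀
  have hqlim : Tendsto (fun δ : ℝ => ∫ t : ℝ, (q (δ + t * I) - q ((-δ : ℝ) + t * I)) * g t)
      (𝓝[>] 0) (𝓝 (∫ t : ℝ, (0 : ℂ))) := by
    refine tendsto_integral_filter_of_dominated_convergence (fun t => (M + M) * ‖g t‖) ?_ ?_
      ((hg.integrable_of_hasCompactSupport hgc).norm.const_mul _) ?_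
    · filter_upwards [hδev] with δ hδ
      have h1 : |δ| ≤ δ₀ := by rw [abs_of_pos hδ.1]; exact hδ.2
      simp only [sub_mul]
      exact ((hqint δ h1).sub (hqint (-δ) (by rwa [abs_neg]))).aestronglyMeasurable
    · filter_upwards [hδev] with δ hδ
      have h1 : |δ| ≤ δ₀ := by rw [abs_of_pos hδ.1]; exact hδ.2
      refine Eventually.of_forall fun t => ?_
      rcases le_or_gt |t| T with ht | ht
      · rw [norm_mul]
        gcongr
        exact (norm_sub_le _ _).trans
          (add_le_add (hM _ (hmem δ t h1 ht)) (hM _ (hmem (-δ) t (by rwa [abs_neg]) ht)))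
      · simp [hgT t ht]
    · refine Eventually.of_forall fun t => ?_
      rcases le_or_gt |t| T with ht | ht
      · have h0 : Tendsto q (𝓝[Set.Icc (-δ₀) δ₀ ×ℂ Set.Icc (-T) T] (t * I)) (𝓝 (q (t * I))) :=
          hq (t * I) (by simpa using hmem 0 t (by simpa using hδ₀.le) ht)
        have h2 : ∀ s : ℝ, |s| = 1 →
            Tendsto (fun δ : ℝ => q ((s * δ : ℝ) + t * I)) (𝓝[>] 0) (𝓝 (q (t * I))) := by
          intro s hs
          refine h0.comp (tendsto_nhdsWithin_iff.mpr ⟨?_, ?_⟩)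
          · have : Tendsto (fun δ : ℝ => ((s * δ : ℝ) : ℂ) + t * I) (𝓝 0)
                (𝓝 ((s * 0 : ℝ) + t * I)) := Continuous.tendsto (by fun_prop) 0
            simpa using this.mono_left nhdsWithin_le_nhds
          · filter_upwards [hδev] with δ hδ
            exact hmem (s * δ) t (by rw [abs_mul, hs, one_mul, abs_of_pos hδ.1]; exact hδ.2) ht
        have h3 := ((h2 1 (by simp)).sub (h2 (-1) (by simp))).mul_const (g t)
        simpa using h3
      · simp [hgT t ht]
  rw [integral_zero] at hqlim
  have hsum := (tendsto_finsetSum Finset.univ fun i _ =>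
    tendsto_integral_poisson hg hMg (γ i)).add hqlim
  have hfin := hsum.const_mul (1 / 2 : ℂ)
  rw [add_zero, ← Finset.mul_sum, show (1 / 2 : ℂ) * (2 * π * ∑ i, g (γ i)) = π * ∑ i, g (γ i) by
    ring] at hfin
  refine hfin.congr' ?_
  filter_upwards [hδev] with δ hδ
  have h1 : |δ| ≤ δ₀ := by rw [abs_of_pos hδ.1]; exact hδ.2
  have h2 : |(-δ)| ≤ δ₀ := by rwa [abs_neg]
  have hp : ∀ i, ∫ t : ℝ, ((2 * δ / (δ ^ 2 + (t - γ i) ^ 2) : ℝ) : ℂ) * g t =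
      (∫ t : ℝ, 1 / (δ + t * I - γ i * I) * g t) -
        ∫ t : ℝ, 1 / ((-δ : ℝ) + t * I - γ i * I) * g t := by
    intro i
    rw [← integral_sub (hpint δ i hδ.1.ne') (hpint (-δ) i (neg_ne_zero.mpr hδ.1.ne'))]
    refine integral_congr_ae (Eventually.of_forall fun t => ?_)
    simp only
    rw [← sub_mul]
    congr 1
    have ha : (δ + t * I - γ i * I : ℂ) ≠ 0 := fun h =>
      hδ.1.ne' (by simpa using congrArg Complex.re h)
    have hb : ((-δ : ℝ) + t * I - γ i * I : ℂ) ≠ 0 := fun h =>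
      hδ.1.ne' (by simpa using congrArg Complex.re h)
    have hc : ((δ : ℂ) ^ 2 + (t - γ i) ^ 2) ≠ 0 := by
      have : 0 < δ ^ 2 + (t - γ i) ^ 2 := by have := hδ.1; positivity
      exact_mod_cast this.ne'
    push_cast at hb ⊢
    rw [div_sub_div _ _ ha hb, div_eq_div_iff hc (mul_ne_zero ha hb)]
    ring_nf
    rw [show (I : ℂ) ^ 2 = -1 from I_sq]
    ring
  have hqs : ∫ t : ℝ, (q (δ + t * I) - q ((-δ : ℝ) + t * I)) * g t =
      (∫ t : ℝ, q (δ + t * I) * g t) - ∫ t : ℝ, q ((-δ : ℝ) + t * I) * g t := by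
    rw [← integral_sub (hqint δ h1) (hqint (-δ) h2)]
    simp only [sub_mul]
  have hA := hDint δ hδ.1.ne' h1
  have hB := hDint (-δ) (neg_ne_zero.mpr hδ.1.ne') h2
  rw [hneg] at hB
  rw [Finset.sum_congr rfl fun i _ => hp i, Finset.sum_sub_distrib, hqs]
  linear_combination (-1 / 2 : ℂ) * hA + (1 / 2 : ℂ) * hB

lemma norm_integral_laplace_mul_le {f : ℝ → ℂ} (hf : Measurable f) {C : ℝ}
    (hC : ∀ u > 0, ‖f u‖ ≤ C) (k : 𝓢(ℝ, ℂ)) {δ : ℝ} (hδ : 0 < δ) :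
    ‖∫ t : ℝ, (∫ u in Set.Ioi (0 : ℝ), f u * Complex.exp (-((δ + t * I) * u))) * k t‖ ≤
      C * ∫ u, ‖angularFourier k u‖ := by
  have h := integral_laplace_mul_eq hf hC k hδ 0
  simp only [ofReal_zero, mul_zero, Complex.exp_zero, mul_one] at h
  rw [h]
  refine norm_setIntegral_mul_angularFourier_le
    (φ := fun u : ℝ => f u * Complex.exp (-(δ * u))) (fun u hu => ?_) k 0
  have h1 : ‖Complex.exp (-(δ * u))‖ ≤ 1 := by
    rw [Complex.norm_exp]
    simpa using mul_nonneg hδ.le (le_of_lt hu)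
  calc ‖f u * Complex.exp (-(δ * u))‖ ≤ C * 1 := by
        rw [norm_mul]
        gcongr
        · exact (norm_nonneg _).trans (hC u hu)
        · exact hC u hu
    _ = C := mul_one C

/-- If `D` is odd with simple poles of residue one on the imaginary axis and `(P(z) - D(z)) / (1/2 + z)`
is the Laplace transform of a function bounded by `C`, then smooth averages of `P` along the
imaginary axis are bounded in terms of `C` and the test function only. -/
lemma norm_integral_mul_le_of_odd {f : ℝ → ℂ} (hf : Measurable f) {C : ℝ}
    (hC : ∀ u > 0, ‖f u‖ ≤ C) {n : ℕ} (γ : Fin n → ℝ) {q D P : ℂ → ℂ} {δ₀ T : ℝ} (hδ₀ : 0 < δ₀)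
    (hq : ContinuousOn q (Set.Icc (-δ₀) δ₀ ×ℂ Set.Icc (-T) T))
    (hD : ∀ z ∈ Set.Icc (-δ₀) δ₀ ×ℂ Set.Icc (-T) T, z.re ≠ 0 →
      D z = ∑ i, 1 / (z - γ i * I) + q z)
    (hodd : ∀ z, D (-z) = -D z)
    (hP : ContinuousOn P (Set.Icc 0 δ₀ ×ℂ Set.Icc (-T) T))
    (hH : ∀ z ∈ Set.Ioc 0 δ₀ ×ℂ Set.Icc (-T) T,
      (1 / 2 + z) * ∫ u in Set.Ioi (0 : ℝ), f u * Complex.exp (-(z * u)) = P z - D z)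
    (g k : 𝓢(ℝ, ℂ)) (heven : ∀ t, g (-t) = g t) (hgT : ∀ t, T < |t| → g t = 0)
    (hk : ∀ t, k t = (1 / 2 + t * I) * g t) :
    ‖∫ t : ℝ, P (t * I) * g t‖ ≤ 2 * (C * ∫ u, ‖angularFourier k u‖) := by
  have hhalf : ∀ t : ℝ, (1 / 2 + t * I : ℂ) ≠ 0 := fun t h => by
    have := congrArg Complex.re h
    norm_num at this
  set K : ℝ := C * ∫ u, ‖angularFourier k u‖ with hK
  have hkT : ∀ t, T < |t| → k t = 0 := fun t ht => by rw [hk, hgT t ht, mul_zero]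
  have hre : ∀ z : ℂ, 0 ≤ z.re → (1 / 2 + z) ≠ 0 := fun z hz h => by
    have := congrArg Complex.re h
    norm_num at this
    linarith
  have hsub : Set.Icc 0 δ₀ ×ℂ Set.Icc (-T) T ⊆ Set.Icc (-δ₀) δ₀ ×ℂ Set.Icc (-T) T :=
    fun z hz => ⟨⟨by linarith [hz.1.1], hz.1.2⟩, hz.2⟩
  have hsub' : Set.Ioc 0 δ₀ ×ℂ Set.Icc (-T) T ⊆ Set.Icc 0 δ₀ ×ℂ Set.Icc (-T) T :=
    fun z hz => ⟨⟨hz.1.1.le, hz.1.2⟩, hz.2⟩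
  have hres : 2 * π * ‖∑ i, g (γ i)‖ ≤ K := by
    have := norm_sum_residues_mul_le hf hC k hkT γ (fun i => -(1 / (1 / 2 + γ i * I)))
      (R := fun z => (P z - q z + ∑ i, 1 / (1 / 2 + γ i * I)) / (1 / 2 + z)) hδ₀ ?_ ?_
    · rw [← norm_neg] at this
      have e : ∑ i, g (γ i) = -∑ i, -(1 / (1 / 2 + γ i * I)) * k (γ i) := by
        rw [← Finset.sum_neg_distrib]
        refine Finset.sum_congr rfl fun i _ => ?_
        rw [hk, neg_mul, neg_neg, ← mul_assoc, one_div_mul_cancel (hhalf (γ i)), one_mul]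
      rwa [e]
    · refine ContinuousOn.div ?_ (by fun_prop) fun z hz => hre z hz.1.1
      exact (hP.sub (hq.mono hsub)).add continuousOn_const
    · intro z hz
      have h1 := hre z hz.1.1.le
      have h2 : ∀ i, (z - γ i * I) ≠ 0 := fun i h => by
        have := congrArg Complex.re h
        simp at this
        exact hz.1.1.ne' this
      have h3 := hH z hz
      rw [hD z (hsub (hsub' hz)) hz.1.1.ne'] at h3
      rw [← mul_right_inj' h1, h3, mul_add, mul_div_cancel₀ _ h1, Finset.mul_sum]
      have h4 : ∀ i, (1 / 2 + z) * (-(1 / (1 / 2 + γ i * I)) / (z - γ i * I)) =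
          -(1 / (z - γ i * I)) - 1 / (1 / 2 + γ i * I) := by
        intro i
        have h5 : ∀ X Y : ℂ, X ≠ 0 → Y ≠ 0 → (X + Y) * (-(1 / Y) / X) = -(1 / X) - 1 / Y := by
          intro X Y hX hY
          field_simp
          ring
        rw [← h5 _ _ (h2 i) (hhalf (γ i))]
        ring
      simp only [h4, Finset.sum_sub_distrib, Finset.sum_neg_distrib]
      ring
  have hlimP := tendsto_integral_vertical hδ₀ hP g.continuous hgT
  have hlimD := tendsto_integral_of_odd γ hδ₀ hq hD hodd g.continuous heven hgT
  have hev : ∀ᶠ δ : ℝ in 𝓝[>] 0,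
      ‖(∫ t : ℝ, P (δ + t * I) * g t) - ∫ t : ℝ, D (δ + t * I) * g t‖ ≤
        K + δ * (C * ∫ u, ‖angularFourier g u‖) := by
    filter_upwards [Ioc_mem_nhdsGT hδ₀] with δ hδ
    have hi : ∀ k' : 𝓢(ℝ, ℂ), Integrable fun t : ℝ =>
        (∫ u in Set.Ioi (0 : ℝ), f u * Complex.exp (-((δ + t * I) * u))) * k' t := by
      intro k'
      refine (integrable_laplace_kernel hf hC k' hδ.1 0).integral_prod_left.congr
        (Eventually.of_forall fun t => ?_)
      simp only [Function.uncurry, ofReal_zero, mul_zero, Complex.exp_zero, mul_one]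
      rw [integral_mul_const]
    have hkg : Integrable fun t : ℝ =>
        (∫ u in Set.Ioi (0 : ℝ), f u * Complex.exp (-((δ + t * I) * u))) * k t +
          δ * ((∫ u in Set.Ioi (0 : ℝ), f u * Complex.exp (-((δ + t * I) * u))) * g t) :=
      (hi k).add ((hi g).const_mul _)
    have e : ∫ t : ℝ, D (δ + t * I) * g t = (∫ t : ℝ, P (δ + t * I) * g t) -
        ((∫ t : ℝ, (∫ u in Set.Ioi (0 : ℝ), f u * Complex.exp (-((δ + t * I) * u))) * k t) +
          δ * ∫ t : ℝ, (∫ u in Set.Ioi (0 : ℝ), f u * Complex.exp (-((δ + t * I) * u))) * g t) := by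
      rw [← integral_const_mul, ← integral_add (hi k) ((hi g).const_mul _),
        ← integral_sub (hlimP.1 δ ⟨hδ.1.le, hδ.2⟩) hkg]
      refine integral_congr_ae (Eventually.of_forall fun t => ?_)
      rcases le_or_gt |t| T with ht | ht
      · have h := hH (δ + t * I) (by simpa [mem_reProdIm] using ⟨hδ, abs_le.mp ht⟩)
        simp only
        rw [hk]
        linear_combination (g t) * h
      · simp [hgT t ht, hkT t ht]
    rw [e, sub_sub_cancel]
    refine (norm_add_le _ _).trans (add_le_add (norm_integral_laplace_mul_le hf hC k hδ.1) ?_)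
    rw [norm_mul, Complex.norm_real, Real.norm_of_nonneg hδ.1.le]
    exact mul_le_mul_of_nonneg_left (norm_integral_laplace_mul_le hf hC g hδ.1) hδ.1.le
  have hlim2 : Tendsto (fun δ : ℝ => K + δ * (C * ∫ u, ‖angularFourier g u‖)) (𝓝[>] 0)
      (𝓝 K) := by
    have : Tendsto (fun δ : ℝ => K + δ * (C * ∫ u, ‖angularFourier g u‖)) (𝓝 0)
      (𝓝 (K + 0 * (C * ∫ u, ‖angularFourier g u‖))) := Continuous.tendsto (by fun_prop) 0
    simpa using this.mono_left nhdsWithin_le_nhds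
  have hle := le_of_tendsto_of_tendsto (hlimP.2.sub hlimD).norm hlim2 hev
  have h1 : ‖(π : ℂ) * ∑ i, g (γ i)‖ ≤ K := by
    rw [norm_mul, Complex.norm_real, Real.norm_of_nonneg Real.pi_pos.le]
    nlinarith [mul_nonneg Real.pi_pos.le (norm_nonneg (∑ i, g (γ i)))]
  have h2 := norm_le_norm_add_norm_sub' (∫ t : ℝ, P (t * I) * g t) (π * ∑ i, g (γ i))
  linarith

lemma exists_eq_pow_mul_of_differentiable (w : ℂ) (m : ℕ) : ∀ {f : ℂ → ℂ}, Differentiable ℂ f →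
    analyticOrderAt f w = m →
    ∃ h : ℂ → ℂ, Differentiable ℂ h ∧ h w ≠ 0 ∧ ∀ z, f z = (z - w) ^ m * h z := by
  induction m with
  | zero =>
    intro f hf hm
    refine ⟨f, hf, fun h0 => ?_, fun z => by simp⟩
    exact (hf.analyticAt w).analyticOrderAt_ne_zero.mpr h0 (by simpa using hm)
  | succ m ih =>
    intro f hf hm
    have h0 : f w = 0 := (hf.analyticAt w).analyticOrderAt_ne_zero.mp (by rw [hm]; simp)
    have hd : Differentiable ℂ (dslope f w) := by
      rw [← differentiableOn_univ] at hf ⊢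
      exact (Complex.differentiableOn_dslope univ_mem).mpr hf
    have he : f = (fun z => z - w) * dslope f w := by
      funext z
      have := sub_smul_dslope f w z
      rw [h0, sub_zero, smul_eq_mul] at this
      exact this.symm
    have h1 : analyticOrderAt (fun z => z - w) w = 1 := by
      refine (AnalyticAt.analyticOrderAt_eq_natCast (n := 1) (by fun_prop)).mpr
        ⟨fun _ => 1, by fun_prop, by simp, by simp⟩
    have h2 : analyticOrderAt (dslope f w) w = m := by
      rw [he, analyticOrderAt_mul (by fun_prop) (hd.analyticAt w), h1] at hm
      have : (1 : ℕ∞) + analyticOrderAt (dslope f w) w = 1 + m := by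
        rw [hm]; push_cast; ring
      exact ENat.add_right_injective_of_ne_top (by simp) this
    obtain ⟨h, hh, hw, hz⟩ := ih hd h2
    refine ⟨h, hh, hw, fun z => ?_⟩
    rw [he, Pi.mul_apply, hz z]
    ring

lemma finite_zeros_on_segment {f : ℂ → ℂ} (hf : Differentiable ℂ f) (hne : ∃ z, f z ≠ 0) (T : ℝ) :
    {t : ℝ | t ∈ Set.Icc (-T) T ∧ f (t * I) = 0}.Finite := by
  by_contra hinf
  obtain ⟨t₀, -, ht₀⟩ := Set.Infinite.exists_accPt_of_subset_isCompact (K := Set.Icc (-T) T) hinf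
    isCompact_Icc fun t ht => ht.1
  rw [accPt_iff_frequently_nhdsNE] at ht₀
  have hcont : Tendsto (fun t : ℝ => (t * I : ℂ)) (𝓝[≠] t₀) (𝓝[≠] (t₀ * I : ℂ)) := by
    refine tendsto_nhdsWithin_iff.mpr ⟨?_, ?_⟩
    · exact (Continuous.tendsto (by fun_prop : Continuous fun t : ℝ => (t * I : ℂ)) t₀).mono_left
        nhdsWithin_le_nhds
    · filter_upwards [self_mem_nhdsWithin] with t ht
      simpa using ht
  have hfr : ∃ᶠ z in 𝓝[≠] (t₀ * I : ℂ), f z = 0 := hcont.frequently (ht₀.mono fun t ht => ht.2)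
  obtain ⟨z, hz⟩ := hne
  exact hz (AnalyticOnNhd.eqOn_zero_of_preconnected_of_frequently_eq_zero (U := Set.univ)
    (fun z _ => hf.analyticAt z) isPreconnected_univ (Set.mem_univ _) hfr (Set.mem_univ z))

lemma exists_factorization_on_finset {f : ℂ → ℂ} (hf : Differentiable ℂ f) (hne : ∃ z, f z ≠ 0)
    (s : Finset ℝ) :
    ∃ (n : ℕ) (γ : Fin n → ℝ) (h : ℂ → ℂ), Differentiable ℂ h ∧ (∀ t ∈ s, h (t * I) ≠ 0) ∧
      ∀ z, f z = (∏ i, (z - γ i * I)) * h z := by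
  induction s using Finset.induction_on with
  | empty => exact ⟨0, Fin.elim0, f, hf, by simp, by simp⟩
  | insert t s hts ih =>
    obtain ⟨n, γ, h, hh, hs, hz⟩ := ih
    have htop : analyticOrderAt h (t * I) ≠ ⊤ := by
      rw [Ne, analyticOrderAt_eq_top]
      intro h0
      have := AnalyticOnNhd.eq_of_eventuallyEq (f := h) (g := 0) (fun z _ => hh.analyticAt z)
        (fun z _ => analyticAt_const) h0
      obtain ⟨z, hz'⟩ := hne
      exact hz' (by rw [hz, this]; simp)
    obtain ⟨m, hm⟩ := ENat.ne_top_iff_exists.mp htop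
    obtain ⟨h', hh', hw, hz'⟩ := exists_eq_pow_mul_of_differentiable (t * I) m hh hm.symm
    refine ⟨n + m, Fin.append γ fun _ => t, h', hh', ?_, fun z => ?_⟩
    · intro t' ht'
      rcases Finset.mem_insert.mp ht' with rfl | ht'
      · exact hw
      · intro h0
        exact hs t' ht' (by rw [hz', h0, mul_zero])
    · rw [hz, hz', Fin.prod_univ_add]
      simp
      ring

/-- Near a segment of the imaginary axis the logarithmic derivative of an entire function is, up to
a continuous function, the sum of the polar parts at the zeros on the segment. -/
lemma exists_logDeriv_eq_sum_add {f : ℂ → ℂ} (hf : Differentiable ℂ f) (hne : ∃ z, f z ≠ 0)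
    (T : ℝ) :
    ∃ (n : ℕ) (γ : Fin n → ℝ) (q : ℂ → ℂ) (δ₀ : ℝ), 0 < δ₀ ∧
      ContinuousOn q (Set.Icc (-δ₀) δ₀ ×ℂ Set.Icc (-T) T) ∧
      ∀ z ∈ Set.Icc (-δ₀) δ₀ ×ℂ Set.Icc (-T) T, z.re ≠ 0 →
        f z ≠ 0 ∧ logDeriv f z = ∑ i, 1 / (z - γ i * I) + q z := by
  obtain ⟨n, γ, h, hh, hs, hz⟩ := exists_factorization_on_finset hf hne
    (finite_zeros_on_segment hf hne T).toFinset
  have hs' : ∀ t ∈ Set.Icc (-T) T, h (t * I) ≠ 0 := by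
    intro t ht
    by_cases h0 : f (t * I) = 0
    · exact hs t (by simpa using ⟨ht, h0⟩)
    · exact fun h1 => h0 (by rw [hz, h1, mul_zero])
  have hcont : Continuous fun t : ℝ => (t * I : ℂ) := by fun_prop
  obtain ⟨δ, hδ, hsub⟩ := (isCompact_Icc.image hcont).exists_thickening_subset_open
    (isOpen_ne_fun hh.continuous continuous_const : IsOpen {z | h z ≠ 0})
    (s := (fun t : ℝ => (t * I : ℂ)) '' Set.Icc (-T) T) (by
      rintro _ ⟨t, ht, rfl⟩
      exact hs' t ht)
  have hK : ∀ z ∈ Set.Icc (-(δ / 2)) (δ / 2) ×ℂ Set.Icc (-T) T, h z ≠ 0 := by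
    intro z hzK
    refine hsub (Metric.mem_thickening_iff.mpr ⟨z.im * I, ⟨z.im, hzK.2, rfl⟩, ?_⟩)
    have : z - z.im * I = (z.re : ℂ) := by
      apply Complex.ext <;> simp
    rw [dist_eq_norm, this, Complex.norm_real, Real.norm_eq_abs]
    exact lt_of_le_of_lt (abs_le.mpr hzK.1) (by linarith)
  refine ⟨n, γ, logDeriv h, δ / 2, half_pos hδ, ?_, fun z hzK hre => ?_⟩
  · exact ContinuousOn.div (hh.contDiff (n := 1)).continuous_deriv_one.continuousOn
      hh.continuous.continuousOn hK
  · have h1 : ∀ i, z - γ i * I ≠ 0 := fun i h0 => hre (by simpa using congrArg Complex.re h0)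
    have he : f = fun z => (∏ i, (z - γ i * I)) * h z := funext hz
    have h2 : ∏ i, (z - γ i * I) ≠ 0 := Finset.prod_ne_zero_iff.mpr fun i _ => h1 i
    refine ⟨by rw [hz]; exact mul_ne_zero h2 (hK z hzK), ?_⟩
    rw [he, logDeriv_mul (f := fun z => ∏ i, (z - γ i * I)) z h2 (hK z hzK) (by fun_prop)
      hh.differentiableAt,
      logDeriv_prod (fun i _ => h1 i) (fun i _ => by fun_prop)]
    congr 1
    refine Finset.sum_congr rfl fun i _ => ?_
    rw [logDeriv_apply]
    simp

lemma differentiableAt_Gamma_of_re_pos {s : ℂ} (hs : 0 < s.re) :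
    DifferentiableAt ℂ Complex.Gamma s := by
  refine Complex.differentiableAt_Gamma s fun m hm => ?_
  rw [hm] at hs
  simp at hs
  linarith [(Nat.cast_nonneg m : (0 : ℝ) ≤ m)]

lemma continuousAt_digamma_of_re_pos {s : ℂ} (hs : 0 < s.re) : ContinuousAt digamma s := by
  have hopen : IsOpen {z : ℂ | 0 < z.re} := isOpen_lt continuous_const continuous_re
  have hd : DifferentiableOn ℂ Complex.Gamma {z : ℂ | 0 < z.re} := fun z hz =>
    (differentiableAt_Gamma_of_re_pos hz).differentiableWithinAt
  have h1 : ContinuousAt (deriv Complex.Gamma) s :=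
    ((hd.deriv hopen).differentiableAt (hopen.mem_nhds hs)).continuousAt
  exact h1.div (differentiableAt_Gamma_of_re_pos hs).continuousAt
    (Complex.Gamma_ne_zero_of_re_pos hs)

/-- On vertical lines, `|Γ(σ + it)| / Γ(σ)` is monotone in `σ`, stated in product form. -/
lemma norm_Gamma_mul_le {σ τ : ℝ} (hσ : 0 < σ) (hστ : σ ≤ τ) (t : ℝ) :
    ‖Complex.Gamma (σ + t * I)‖ * ‖Complex.Gamma τ‖ ≤
      ‖Complex.Gamma (τ + t * I)‖ * ‖Complex.Gamma σ‖ := by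
  have hτ : 0 < τ := hσ.trans_le hστ
  have key : ∀ s : ℂ, Tendsto (fun n => ‖Complex.GammaSeq s n‖) atTop (𝓝 ‖Complex.Gamma s‖) :=
    fun s => (Complex.GammaSeq_tendsto_Gamma s).norm
  refine le_of_tendsto_of_tendsto ((key _).mul (key _)) ((key _).mul (key _)) ?_
  filter_upwards [eventually_gt_atTop 0] with n hn
  have hn' : (0 : ℝ) < n := by exact_mod_cast hn
  have hpow : ∀ a b : ℝ, ‖(n : ℂ) ^ ((a : ℂ) + b * I)‖ = (n : ℝ) ^ a := by
    intro a b
    rw [← Complex.ofReal_natCast, Complex.norm_cpow_eq_rpow_re_of_pos hn']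
    simp
  have hpow' : ∀ a : ℝ, ‖(n : ℂ) ^ (a : ℂ)‖ = (n : ℝ) ^ a := by
    intro a
    simp
  simp only [Complex.GammaSeq, norm_div, norm_mul, hpow, hpow', norm_prod]
  have hP : ∀ a b : ℝ, 0 < a → 0 < ∏ j ∈ Finset.range (n + 1), ‖(a : ℂ) + b * I + j‖ := by
    intro a b ha
    refine Finset.prod_pos fun j _ => norm_pos_iff.mpr fun h => ?_
    have := congrArg Complex.re h
    simp at this
    linarith [(Nat.cast_nonneg j : (0 : ℝ) ≤ j)]
  have hP' : ∀ a : ℝ, 0 < a → 0 < ∏ j ∈ Finset.range (n + 1), ‖(a : ℂ) + j‖ := by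
    intro a ha
    simpa only [ofReal_zero, zero_mul, add_zero] using hP a 0 ha
  have hmain : (∏ j ∈ Finset.range (n + 1), ‖(τ : ℂ) + t * I + j‖) *
      (∏ j ∈ Finset.range (n + 1), ‖(σ : ℂ) + j‖) ≤
      (∏ j ∈ Finset.range (n + 1), ‖(σ : ℂ) + t * I + j‖) *
      (∏ j ∈ Finset.range (n + 1), ‖(τ : ℂ) + j‖) := by
    rw [← Finset.prod_mul_distrib, ← Finset.prod_mul_distrib]
    refine Finset.prod_le_prod (fun j _ => by positivity) fun j _ => ?_
    have hj : (0 : ℝ) ≤ j := Nat.cast_nonneg j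
    have e : ∀ a : ℝ, ‖(a : ℂ) + t * I + j‖ = √((a + j) ^ 2 + t ^ 2) := by
      intro a
      rw [show (a : ℂ) + t * I + j = ((a + j : ℝ) : ℂ) + t * I by push_cast; ring,
        Complex.norm_add_mul_I]
    have e' : ∀ a : ℝ, ‖(a : ℂ) + j‖ = √((a + j) ^ 2) := by
      intro a
      rw [show (a : ℂ) + j = ((a + j : ℝ) : ℂ) by push_cast; ring, Complex.norm_real,
        Real.sqrt_sq_eq_abs, Real.norm_eq_abs]
    rw [e, e, e', e', ← Real.sqrt_mul (by positivity), ← Real.sqrt_mul (by positivity)]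
    apply Real.sqrt_le_sqrt
    have : (σ + j) ^ 2 ≤ (τ + j) ^ 2 := by gcongr
    nlinarith [sq_nonneg t]
  rw [div_mul_div_comm, div_mul_div_comm, div_le_div_iff₀ (mul_pos (hP _ _ hσ) (hP' _ hτ))
    (mul_pos (hP _ _ hτ) (hP' _ hσ))]
  calc _ = ((n : ℝ) ^ σ * ‖((n.factorial : ℕ) : ℂ)‖ * ((n : ℝ) ^ τ * ‖((n.factorial : ℕ) : ℂ)‖)) *
        ((∏ j ∈ Finset.range (n + 1), ‖(τ : ℂ) + t * I + j‖) *
      (∏ j ∈ Finset.range (n + 1), ‖(σ : ℂ) + j‖)) := by ring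
    _ ≤ ((n : ℝ) ^ σ * ‖((n.factorial : ℕ) : ℂ)‖ * ((n : ℝ) ^ τ * ‖((n.factorial : ℕ) : ℂ)‖)) *
        ((∏ j ∈ Finset.range (n + 1), ‖(σ : ℂ) + t * I + j‖) *
      (∏ j ∈ Finset.range (n + 1), ‖(τ : ℂ) + j‖)) := by gcongr
    _ = _ := by ring

lemma hasDerivAt_log_norm_Gamma {σ : ℝ} (hσ : 0 < σ) (t : ℝ) :
    HasDerivAt (fun x : ℝ => Real.log ‖Complex.Gamma (x + t * I)‖)
      (digamma (σ + t * I)).re σ := by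
  have hre : 0 < ((σ : ℂ) + t * I).re := by simpa using hσ
  have h0 := Complex.Gamma_ne_zero_of_re_pos hre
  have h1 : HasDerivAt (fun x : ℝ => Complex.Gamma (x + t * I))
      (deriv Complex.Gamma (σ + t * I)) σ :=
    ((differentiableAt_Gamma_of_re_pos hre).hasDerivAt.comp_add_const (σ : ℂ) (t * I)).comp_ofReal
  have h3 := h1.norm_sq
  have h4 := (h3.log (by positivity)).const_mul (1 / 2 : ℝ)
  have e : (fun x : ℝ => Real.log ‖Complex.Gamma (x + t * I)‖) =
      fun x : ℝ => 1 / 2 * Real.log (‖Complex.Gamma (x + t * I)‖ ^ 2) := by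
    funext x
    rw [Real.log_pow]; push_cast; ring
  have e2 : (digamma (σ + t * I)).re = 1 / 2 *
      (2 * inner ℝ (Complex.Gamma (σ + t * I)) (deriv Complex.Gamma (σ + t * I)) /
        ‖Complex.Gamma (σ + t * I)‖ ^ 2) := by
    rw [digamma_def, logDeriv_apply, Complex.div_re, ← Complex.normSq_eq_norm_sq, Complex.inner]
    simp
    field_simp
  rw [e, e2]
  exact h4

lemma re_digamma_ofReal_le {σ : ℝ} (hσ : 0 < σ) (t : ℝ) :
    (digamma σ).re ≤ (digamma (σ + t * I)).re := by
  have hd := (hasDerivAt_log_norm_Gamma hσ t).sub (hasDerivAt_log_norm_Gamma hσ 0)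
  have hmono : MonotoneOn ((fun x : ℝ => Real.log ‖Complex.Gamma (x + t * I)‖) -
      fun x : ℝ => Real.log ‖Complex.Gamma (x + (0 : ℝ) * I)‖) (Set.Ioi 0) := by
    intro a ha b hb hab
    have h0 : ∀ x : ℝ, 0 < x → ∀ y : ℝ, 0 < ‖Complex.Gamma (x + y * I)‖ := fun x hx y =>
      norm_pos_iff.mpr (Complex.Gamma_ne_zero_of_re_pos (by simpa using hx))
    have h1 := norm_Gamma_mul_le ha hab t
    have h2 : ∀ x : ℝ, Complex.Gamma x = Complex.Gamma (x + (0 : ℝ) * I) := by simp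
    rw [h2 a, h2 b] at h1
    have h3 := Real.log_le_log (mul_pos (h0 a ha t) (h0 b hb 0)) h1
    rw [Real.log_mul (h0 a ha t).ne' (h0 b hb 0).ne',
      Real.log_mul (h0 b hb t).ne' (h0 a ha 0).ne'] at h3
    simp only [Pi.sub_apply]
    linarith
  have hnn := hmono.derivWithin_nonneg (x := σ)
  rw [derivWithin_of_isOpen isOpen_Ioi hσ, hd.deriv] at hnn
  simpa using hnn

lemma exists_forall_le_re_digamma {σ : ℝ} (hσ : 0 < σ) (A : ℝ) :
    ∃ t₀ : ℝ, ∀ t : ℝ, t₀ ≤ |t| → A ≤ (digamma (σ + t * I)).re := by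
  have step : ∀ n : ℕ, ∀ t : ℝ, digamma (σ + t * I + n) =
      digamma (σ + t * I) + ∑ k ∈ Finset.range n, (σ + t * I + k : ℂ)⁻¹ := by
    intro n t
    induction n with
    | zero => simp
    | succ n ih =>
      rw [Finset.sum_range_succ, ← add_assoc, ← ih, ← digamma_apply_add_one]
      · push_cast; ring_nf
      · intro m hm
        have := congrArg Complex.re hm
        simp at this
        linarith [(Nat.cast_nonneg n : (0 : ℝ) ≤ n), (Nat.cast_nonneg m : (0 : ℝ) ≤ m)]
  have hre : ∀ (k : ℕ) (t : ℝ), ((σ + t * I + k : ℂ)⁻¹).re = (σ + k) / ((σ + k) ^ 2 + t ^ 2) := by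
    intro k t
    rw [Complex.inv_re, Complex.normSq_apply]
    simp [sq]
  have hdiv : Tendsto (fun n : ℕ => ∑ k ∈ Finset.range n, (σ + k)⁻¹) atTop atTop := by
    refine tendsto_atTop_mono (f := fun n : ℕ =>
      (σ + 1)⁻¹ * ∑ k ∈ Finset.range n, (1 / ((k : ℝ) + 1))) (fun n => ?_)
      (Real.tendsto_sum_range_one_div_nat_succ_atTop.const_mul_atTop (by positivity))
    rw [Finset.mul_sum]
    refine Finset.sum_le_sum fun k _ => ?_
    have hk : (0 : ℝ) ≤ k := Nat.cast_nonneg k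
    rw [one_div, ← mul_inv]
    apply inv_anti₀ (by positivity)
    nlinarith
  obtain ⟨n, hn⟩ := (hdiv.eventually_ge_atTop (A + 1 - (digamma σ).re)).exists
  refine ⟨n * (σ + n) + 1, fun t ht => ?_⟩
  have h1 := congrArg Complex.re (step n t)
  have h2 := congrArg Complex.re (step n 0)
  have h3 := re_digamma_ofReal_le (σ := σ + n) (by positivity) t
  have hn0 : (0 : ℝ) ≤ n := Nat.cast_nonneg n
  have e1 : (((σ + n : ℝ) : ℂ) + t * I) = σ + t * I + n := by push_cast; ring
  have e2 : (((σ + n : ℝ) : ℂ)) = σ + (0 : ℝ) * I + n := by push_cast; ring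
  rw [e1, e2, h1, h2, Complex.add_re, Complex.add_re, Complex.re_sum, Complex.re_sum] at h3
  simp only [hre] at h3
  have h4 : ∑ k ∈ Finset.range n, (σ + k) / ((σ + k) ^ 2 + (0 : ℝ) ^ 2) =
      ∑ k ∈ Finset.range n, (σ + k)⁻¹ := by
    refine Finset.sum_congr rfl fun k _ => ?_
    have : σ + k ≠ 0 := by positivity
    field_simp
    ring
  have h5 : ∑ k ∈ Finset.range n, (σ + k) / ((σ + k) ^ 2 + t ^ 2) ≤ 1 := by
    have ht2 : (n * (σ + n) + 1) ^ 2 ≤ t ^ 2 := by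
      rw [← sq_abs t]; gcongr
    have hp : 0 ≤ n * (σ + n) := by positivity
    calc ∑ k ∈ Finset.range n, (σ + k) / ((σ + k) ^ 2 + t ^ 2)
        ≤ ∑ k ∈ Finset.range n, (σ + n) / (n * (σ + n) + 1) := by
          refine Finset.sum_le_sum fun k hk => ?_
          have hk : (k : ℝ) ≤ n := by exact_mod_cast (Finset.mem_range.mp hk).le
          have hk0 : (0 : ℝ) ≤ k := Nat.cast_nonneg k
          apply div_le_div₀ <;> nlinarith [sq_nonneg (σ + k)]
      _ = n * (σ + n) / (n * (σ + n) + 1) := by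
          rw [Finset.sum_const, Finset.card_range, nsmul_eq_mul, mul_div_assoc]
      _ ≤ 1 := by rw [div_le_one (by positivity)]; linarith
  rw [h4] at h3
  simp at h3
  linarith

/-- Dilates of a fixed smooth bump, with linear growth of the `L¹` norm of the Fourier transform of
`(1 / 2 + i t) g(t)`. -/
lemma exists_test_functions :
    ∃ (φ : ℝ → ℝ) (M : ℝ), 0 ≤ M ∧ Continuous φ ∧ (∀ t, φ (-t) = φ t) ∧ (∀ t, 0 ≤ φ t) ∧
      (∀ t, φ t ≤ 1) ∧ (∀ t, |t| ≤ 1 / 2 → φ t = 1) ∧ (∀ t, 1 ≤ |t| → φ t = 0) ∧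
      ∀ T : ℝ, 1 ≤ T → ∃ g k : 𝓢(ℝ, ℂ), (∀ t, g t = φ (t / T)) ∧
        (∀ t, k t = (1 / 2 + t * I) * g t) ∧ ∫ u, ‖angularFourier k u‖ ≤ M * T := by
  let φ : ContDiffBump (0 : ℝ) := ⟨1 / 2, 1, by norm_num, by norm_num⟩
  have hφ0 : ∀ t, 1 ≤ |t| → φ t = 0 := fun t ht =>
    φ.zero_of_le_dist (by simpa [φ, Real.dist_eq] using ht)
  have hsch : ∀ (T : ℝ) (p : ℝ → ℂ), 1 ≤ T → ContDiff ℝ (⊤ : ℕ∞) p →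
      ∃ g : 𝓢(ℝ, ℂ), ∀ t, g t = p t * φ (t / T) := by
    intro T p hT hp
    have hT0 : 0 < T := by linarith
    have hc : HasCompactSupport fun t : ℝ => p t * φ (t / T) := by
      refine HasCompactSupport.intro (K := Set.Icc (-T) T) isCompact_Icc fun t ht => ?_
      have h1 : T < |t| := not_le.mp fun h => ht (abs_le.mp h)
      rw [hφ0 (t / T) (by rw [abs_div, abs_of_pos hT0, le_div_iff₀ hT0]; linarith)]
      simp
    have hd : ContDiff ℝ (⊤ : ℕ∞) fun t : ℝ => p t * φ (t / T) := by
      refine hp.mul ?_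
      exact Complex.ofRealCLM.contDiff.comp (φ.contDiff.comp (contDiff_id.div_const T))
    exact ⟨hc.toSchwartzMap hd, fun t => hc.toSchwartzMap_toFun hd t⟩
  obtain ⟨g₀, hg₀⟩ := hsch 1 (fun _ => 1) le_rfl contDiff_const
  obtain ⟨g₁, hg₁⟩ := hsch 1 (fun t => t) le_rfl Complex.ofRealCLM.contDiff
  have hn : ∀ h : 𝓢(ℝ, ℂ), 0 ≤ ∫ u, ‖angularFourier h u‖ := fun h =>
    integral_nonneg fun u => norm_nonneg _
  refine ⟨φ, (∫ u, ‖angularFourier g₀ u‖) + ∫ u, ‖angularFourier g₁ u‖, add_nonneg (hn _) (hn _),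
    φ.continuous, φ.neg, fun t => φ.nonneg, fun t => φ.le_one, fun t ht =>
    φ.one_of_mem_closedBall (by simpa [φ, Real.dist_eq] using ht), hφ0, fun T hT => ?_⟩
  have hT0 : 0 < T := by linarith
  obtain ⟨g, hg⟩ := hsch T (fun _ => 1) hT contDiff_const
  obtain ⟨k, hk⟩ := hsch T (fun t => 1 / 2 + t * I) hT
    (contDiff_const.add (Complex.ofRealCLM.contDiff.mul contDiff_const))
  refine ⟨g, k, fun t => by simp [hg], fun t => by rw [hk, hg, one_mul], ?_⟩
  have hang : ∀ u, angularFourier k u =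
      T * (1 / 2 * angularFourier g₀ (T * u) + T * I * angularFourier g₁ (T * u)) := by
    intro u
    have hi : ∀ h : 𝓢(ℝ, ℂ),
        Integrable fun t : ℝ => h t * Complex.exp (-(I * (t * (T * u : ℝ)))) := by
      intro h
      refine h.integrable.norm.mono' ((h.continuous.mul (by fun_prop)).aestronglyMeasurable)
        (Eventually.of_forall fun t => ?_)
      rw [norm_mul, Complex.norm_exp]
      simp
    rw [angularFourier_eq, angularFourier_eq, angularFourier_eq, ← integral_const_mul,
      ← integral_const_mul, ← integral_add ((hi g₀).const_mul _) ((hi g₁).const_mul _)]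
    have h2 := MeasureTheory.Measure.integral_comp_mul_left
      (fun t : ℝ => k t * Complex.exp (-(I * (t * u)))) T
    rw [abs_of_pos (inv_pos.mpr hT0), real_smul] at h2
    have hTc : (T : ℂ) ≠ 0 := by exact_mod_cast hT0.ne'
    have h3 : ∫ t : ℝ, k t * Complex.exp (-(I * (t * u))) =
        T * ∫ t : ℝ, k (T * t) * Complex.exp (-(I * ((T * t : ℝ) * u))) := by
      rw [h2, ofReal_inv, ← mul_assoc, mul_inv_cancel₀ hTc, one_mul]
    rw [h3]
    congr 1
    refine integral_congr_ae (Eventually.of_forall fun t => ?_)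
    have h4 : T * t / T = t := by field_simp
    simp only [hk, hg₀, hg₁, h4, div_one]
    push_cast
    ring_nf
  have hc : ∀ h : 𝓢(ℝ, ℂ), T * ∫ u, ‖angularFourier h (T * u)‖ = ∫ u, ‖angularFourier h u‖ := by
    intro h
    have h2 := MeasureTheory.Measure.integral_comp_mul_left
      (fun t : ℝ => ‖angularFourier h t‖) T
    rw [abs_of_pos (inv_pos.mpr hT0), smul_eq_mul] at h2
    rw [h2]
    field_simp
  have hib : ∀ h : 𝓢(ℝ, ℂ), Integrable fun u : ℝ => ‖angularFourier h (T * u)‖ := fun h =>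
    ((integrable_angularFourier h).comp_mul_left' hT0.ne').norm
  calc ∫ u, ‖angularFourier k u‖
      ≤ ∫ u, (T * ‖angularFourier g₀ (T * u)‖ + T * (T * ‖angularFourier g₁ (T * u)‖)) := by
        refine integral_mono (integrable_angularFourier k).norm
          (((hib g₀).const_mul T).add (((hib g₁).const_mul T).const_mul T)) fun u => ?_
        simp only
        rw [hang u, norm_mul, Complex.norm_real, Real.norm_of_nonneg hT0.le, ← mul_add]
        gcongr
        refine (norm_add_le _ _).trans (add_le_add ?_ ?_)
        · rw [norm_mul]
          have : ‖(1 / 2 : ℂ)‖ ≤ 1 := by norm_num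
          exact mul_le_of_le_one_left (norm_nonneg _) this
        · rw [norm_mul, norm_mul, Complex.norm_I, Complex.norm_real, Real.norm_of_nonneg hT0.le,
            mul_one]
    _ = (∫ u, ‖angularFourier g₀ u‖) + T * ∫ u, ‖angularFourier g₁ u‖ := by
        rw [integral_add ((hib g₀).const_mul T) (((hib g₁).const_mul T).const_mul T),
          integral_const_mul, integral_const_mul, integral_const_mul, hc, hc]
    _ ≤ ((∫ u, ‖angularFourier g₀ u‖) + ∫ u, ‖angularFourier g₁ u‖) * T := by
        nlinarith [hn g₀, hn g₁]

/-- Smooth averages over `[-T, T]` of a function tending to infinity are not `O(T)`. -/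
lemma exists_lt_integral_mul_dilate {φ : ℝ → ℝ} (hφc : Continuous φ) (hφ0 : ∀ t, 0 ≤ φ t)
    (hφ1 : ∀ t, φ t ≤ 1) (hφ : ∀ t, |t| ≤ 1 / 2 → φ t = 1) (hφs : ∀ t, 1 ≤ |t| → φ t = 0)
    {p : ℝ → ℝ} (hp : Continuous p) {B : ℝ} (hB : ∀ t, -B ≤ p t)
    (htop : ∀ A, ∃ t₀, ∀ t, t₀ ≤ |t| → A ≤ p t) (L : ℝ) :
    ∃ T ≥ 1, L * T < ∫ t, p t * φ (t / T) := by
  set A : ℝ := |L| + 1 with hA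
  have hA0 : 0 < A := by positivity
  obtain ⟨t₁, ht₁⟩ := htop A
  set t₀ : ℝ := max t₁ 0
  have ht₀ : ∀ t, t₀ ≤ |t| → A ≤ p t := fun t ht => ht₁ t ((le_max_left _ _).trans ht)
  have ht₀0 : 0 ≤ t₀ := le_max_right _ _
  set S : ℝ := (A + |B|) * (2 * t₀) with hS
  have hS0 : 0 ≤ S := by positivity
  set T : ℝ := S + 1 with hT
  have hT0 : 0 < T := by linarith
  have hi : Integrable fun t => p t * φ (t / T) := by
    refine Continuous.integrable_of_hasCompactSupport (by fun_prop) ?_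
    refine HasCompactSupport.intro (K := Set.Icc (-T) T) isCompact_Icc fun t ht => ?_
    have h1 : T < |t| := not_le.mp fun h => ht (abs_le.mp h)
    rw [hφs (t / T) (by rw [abs_div, abs_of_pos hT0, le_div_iff₀ hT0]; linarith), mul_zero]
  have hind : ∀ (s : ℝ) (c : ℝ), Integrable ((Set.Icc (-s) s).indicator fun _ : ℝ => c) := by
    intro s c
    rw [integrable_indicator_iff measurableSet_Icc]
    exact integrableOn_const (by simp)
  have hval : ∀ (s : ℝ) (c : ℝ), 0 ≤ s →
      ∫ t, (Set.Icc (-s) s).indicator (fun _ : ℝ => c) t = c * (2 * s) := by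
    intro s c hs
    rw [integral_indicator measurableSet_Icc, setIntegral_const, smul_eq_mul, Real.volume_real_Icc,
      max_eq_left (by linarith)]
    ring
  refine ⟨T, by linarith, ?_⟩
  have hle : ∫ t, ((Set.Icc (-(T / 2)) (T / 2)).indicator (fun _ : ℝ => A) t -
      (Set.Icc (-t₀) t₀).indicator (fun _ : ℝ => A + |B|) t) ≤ ∫ t, p t * φ (t / T) := by
    refine integral_mono ((hind _ _).sub (hind _ _)) hi fun t => ?_
    simp only
    have hB' : 0 ≤ |B| := abs_nonneg B
    have hind1 : (Set.Icc (-(T / 2)) (T / 2)).indicator (fun _ : ℝ => A) t ≤ A :=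
      Set.indicator_le_self' (fun _ _ => hA0.le) t
    by_cases h1 : t ∈ Set.Icc (-t₀) t₀
    · rw [Set.indicator_of_mem h1]
      have := neg_abs_le B
      have h3 := le_abs_self B
      nlinarith [hB t, hφ0 (t / T), hφ1 (t / T), mul_nonneg hB' (hφ0 (t / T))]
    · rw [Set.indicator_of_notMem h1, sub_zero]
      have h2 : A ≤ p t := ht₀ t (le_of_lt (not_le.mp fun h => h1 (abs_le.mp h)))
      by_cases h3 : t ∈ Set.Icc (-(T / 2)) (T / 2)
      · rw [Set.indicator_of_mem h3, hφ (t / T), mul_one]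
        · exact h2
        · rw [abs_div, abs_of_pos hT0, div_le_iff₀ hT0]
          have := abs_le.mpr h3
          linarith
      · rw [Set.indicator_of_notMem h3]
        exact mul_nonneg (hA0.le.trans h2) (hφ0 _)
  rw [integral_sub (hind _ _) (hind _ _), hval _ _ (by linarith), hval _ _ ht₀0] at hle
  have := le_abs_self L
  nlinarith

section DirichletL

open DirichletCharacter

variable {N : ℕ} {χ : DirichletCharacter ℂ N}

lemma DirichletCharacter.Odd.ne_one (hχ : χ.Odd) : χ ≠ 1 := by
  rintro rfl
  have h : (1 : DirichletCharacter ℂ N) (-1) = -1 := hχ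
  rw [MulChar.one_apply (isUnit_one.neg)] at h
  norm_num at h

lemma gammaFactor_ne_zero (hχ : χ.Odd) {s : ℂ} (hs : -1 < s.re) : gammaFactor χ s ≠ 0 := by
  rw [hχ.gammaFactor_def]
  exact Gammaℝ_ne_zero_of_re_pos (by rw [Complex.add_re, Complex.one_re]; linarith)

variable [NeZero N]

/-- The completed `L`-function of `χ`, recentred at `1 / 2` and normalised so that its functional
equation for a real primitive character is `z ↦ -z`. -/
noncomputable def centeredXi (χ : DirichletCharacter ℂ N) (z : ℂ) : ℂ :=
  Complex.exp (z * (Real.log N / 2 : ℝ)) * completedLFunction χ (1 / 2 + z)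

lemma differentiable_centeredXi (hχ : χ ≠ 1) : Differentiable ℂ (centeredXi χ) := by
  have h := differentiable_completedLFunction hχ
  unfold centeredXi
  fun_prop

lemma centeredXi_neg (hprim : χ.IsPrimitive) (hreal : χ⁻¹ = χ) (z : ℂ) :
    centeredXi χ (-z) = rootNumber χ * centeredXi χ z := by
  have hN : (N : ℂ) ≠ 0 := Nat.cast_ne_zero.mpr (NeZero.ne N)
  have h := IsPrimitive.completedLFunction_one_sub hprim (1 / 2 + z)
  rw [hreal, show (1 : ℂ) - (1 / 2 + z) = 1 / 2 + -z by ring,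
    show (1 : ℂ) / 2 + z - 1 / 2 = z by ring] at h
  have he : Complex.exp (-z * (Real.log N / 2 : ℝ)) * (N : ℂ) ^ z =
      Complex.exp (z * (Real.log N / 2 : ℝ)) := by
    rw [Complex.cpow_def_of_ne_zero hN, ← Complex.natCast_log, ← Complex.exp_add]
    push_cast
    congr 1
    ring
  rw [centeredXi, centeredXi, h, ← he]
  ring

lemma completedLFunction_eq_mul_gammaFactor (hχ : χ.Odd) {s : ℂ} (hs : -1 < s.re) :
    completedLFunction χ s = gammaFactor χ s * LFunction χ s := by
  have hN : N ≠ 1 := fun h => hχ.ne_one (level_one' χ h)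
  rw [LFunction_eq_completed_div_gammaFactor χ s (Or.inr hN),
    mul_div_cancel₀ _ (gammaFactor_ne_zero hχ hs)]

lemma exists_centeredXi_ne_zero (hχ : χ.Odd) : ∃ z, centeredXi χ z ≠ 0 := by
  refine ⟨1 / 2, mul_ne_zero (Complex.exp_ne_zero _) ?_⟩
  have h1 : (1 / 2 + 1 / 2 : ℂ) = 1 := by norm_num
  rw [h1, completedLFunction_eq_mul_gammaFactor hχ (by simp)]
  exact mul_ne_zero (gammaFactor_ne_zero hχ (by simp))
    (LFunction_ne_zero_of_one_le_re χ (Or.inl hχ.ne_one) (by simp))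

lemma logDeriv_centeredXi_neg (hχ : χ.Odd) (hprim : χ.IsPrimitive) (hreal : χ⁻¹ = χ) (z : ℂ) :
    logDeriv (centeredXi χ) (-z) = -logDeriv (centeredXi χ) z := by
  have hW : rootNumber χ ≠ 0 := by
    obtain ⟨z₀, hz₀⟩ := exists_centeredXi_ne_zero hχ
    intro h0
    have := centeredXi_neg hprim hreal (-z₀)
    rw [neg_neg, h0, zero_mul] at this
    exact hz₀ this
  have hcomp : (centeredXi χ) ∘ Neg.neg = fun z => rootNumber χ * centeredXi χ z :=
    funext (centeredXi_neg hprim hreal)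
  have h1 : logDeriv (centeredXi χ ∘ Neg.neg) z = logDeriv (centeredXi χ) (-z) * deriv Neg.neg z :=
    logDeriv_comp (differentiable_centeredXi hχ.ne_one _) (by fun_prop)
  rw [hcomp, logDeriv_const_mul z _ hW, deriv_neg] at h1
  rw [h1]
  ring

/-- The archimedean part of the logarithmic derivative of `centeredXi χ` for odd `χ` mod `N`. -/
noncomputable def archimedeanTerm (N : ℕ) (z : ℂ) : ℂ :=
  (Real.log N / 2 - Real.log π / 2 : ℝ) + digamma (3 / 4 + z / 2) / 2

lemma logDeriv_centeredXi (hχ : χ.Odd) {z : ℂ} (hz : 0 < z.re) (hne : centeredXi χ z ≠ 0) :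
    logDeriv (centeredXi χ) z =
      archimedeanTerm N z + logDeriv (LFunction χ) (1 / 2 + z) := by
  have hre : 0 < (3 / 4 + z / 2).re := by
    have : (3 / 4 + z / 2 : ℂ).re = 3 / 4 + z.re / 2 := by
      simp [Complex.add_re, show (3 / 4 : ℂ) = ((3 / 4 : ℝ) : ℂ) by push_cast; ring,
        show (z / 2 : ℂ) = z / ((2 : ℝ) : ℂ) by push_cast; ring, Complex.div_ofReal_re,
        -Complex.ofReal_div, -Complex.ofReal_ofNat, Complex.ofReal_re]
    rw [this]; linarith
  have hev : centeredXi χ =ᶠ[𝓝 z] fun w => Complex.exp (w * (Real.log N / 2 : ℝ)) *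
      (Complex.exp (-((3 / 4 + w / 2) * Real.log π)) * Complex.Gamma (3 / 4 + w / 2) *
        LFunction χ (1 / 2 + w)) := by
    filter_upwards [(isOpen_lt continuous_const Complex.continuous_re).mem_nhds hz] with w hw
    have hw' : 0 < w.re := hw
    rw [centeredXi, completedLFunction_eq_mul_gammaFactor hχ
      (by simp only [Complex.add_re]; norm_num; linarith), hχ.gammaFactor_def, Complex.Gammaℝ_def,
      Complex.cpow_def_of_ne_zero (by exact_mod_cast Real.pi_ne_zero),
      ← Complex.ofReal_log Real.pi_pos.le]
    ring_nf
  have hG : DifferentiableAt ℂ Complex.Gamma (3 / 4 + z / 2) :=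
    differentiableAt_Gamma_of_re_pos hre
  have hL : Differentiable ℂ (LFunction χ) := differentiable_LFunction hχ.ne_one
  have hGne : Complex.Gamma (3 / 4 + z / 2) ≠ 0 := Complex.Gamma_ne_zero_of_re_pos hre
  have hLne : LFunction χ (1 / 2 + z) ≠ 0 := by
    rw [hev.self_of_nhds] at hne
    exact right_ne_zero_of_mul (right_ne_zero_of_mul hne)
  have hGd : HasDerivAt (fun w : ℂ => Complex.Gamma (3 / 4 + w / 2))
      (deriv Complex.Gamma (3 / 4 + z / 2) * (1 / 2)) z :=
    hG.hasDerivAt.comp z (((hasDerivAt_id z).div_const 2).const_add _)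
  have hLd : HasDerivAt (fun w : ℂ => LFunction χ (1 / 2 + w))
      (deriv (LFunction χ) (1 / 2 + z) * 1) z :=
    (hL _).hasDerivAt.comp z ((hasDerivAt_id z).const_add _)
  have he1 : HasDerivAt (fun w : ℂ => Complex.exp (w * (Real.log N / 2 : ℝ)))
      (Complex.exp (z * (Real.log N / 2 : ℝ)) * (1 * (Real.log N / 2 : ℝ))) z :=
    ((hasDerivAt_id z).mul_const _).cexp
  have he2 : HasDerivAt (fun w : ℂ => Complex.exp (-((3 / 4 + w / 2) * Real.log π)))
      (Complex.exp (-((3 / 4 + z / 2) * Real.log π)) * (-((1 / 2) * Real.log π))) z :=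
    (((((hasDerivAt_id z).div_const 2).const_add (3 / 4)).mul_const _).neg).cexp
  have hd := he1.mul ((he2.mul hGd).mul hLd)
  have hE1 := Complex.exp_ne_zero (z * (Real.log N / 2 : ℝ))
  have hE2 := Complex.exp_ne_zero (-((3 / 4 + z / 2) * Real.log π))
  have hval : deriv (centeredXi χ) z = _ := hev.deriv_eq.trans hd.deriv
  rw [logDeriv_apply, hval, hev.self_of_nhds, archimedeanTerm, digamma_def, logDeriv_apply,
    logDeriv_apply]
  push_cast at hE1 ⊢
  simp only [Pi.mul_apply]
  generalize Complex.exp (z * (Complex.log N / 2)) = E₁ at *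
  generalize Complex.exp (-((3 / 4 + z / 2) * Real.log π)) = E₂ at *
  generalize Complex.Gamma (3 / 4 + z / 2) = A at *
  generalize deriv Complex.Gamma (3 / 4 + z / 2) = A' at *
  generalize LFunction χ (1 / 2 + z) = B at *
  generalize deriv (LFunction χ) (1 / 2 + z) = B' at *
  field_simp
  ring

end DirichletL

lemma differentiableAt_laplace {f : ℝ → ℂ} (hf : Measurable f) {C : ℝ} (hC : ∀ u > 0, ‖f u‖ ≤ C)
    {z : ℂ} (hz : 0 < z.re) :
    DifferentiableAt ℂ (fun w : ℂ => ∫ u in Set.Ioi (0 : ℝ), f u * Complex.exp (-(w * u))) z := by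
  have hC0 : 0 ≤ C := (norm_nonneg _).trans (hC 1 one_pos)
  have hε : 0 < z.re / 2 := by linarith
  have hre (w : ℂ) (u : ℝ) : (-(w * u)).re = -(w.re * u) := by simp
  have hmeas (w : ℂ) : Measurable fun u : ℝ => f u * Complex.exp (-(w * u)) := by fun_prop
  refine (hasDerivAt_integral_of_dominated_loc_of_deriv_le (μ := volume.restrict (Set.Ioi 0))
    (F := fun (w : ℂ) (u : ℝ) => f u * Complex.exp (-(w * u)))
    (F' := fun (w : ℂ) (u : ℝ) => f u * (Complex.exp (-(w * u)) * -(1 * u)))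
    (bound := fun u => C * (u ^ (1 : ℝ) * Real.exp (-(z.re / 2) * u ^ (1 : ℝ))))
    (Metric.ball_mem_nhds z hε) (Eventually.of_forall fun w => (hmeas w).aestronglyMeasurable)
    ?_ ?_ ?_ ?_ ?_).2.differentiableAt
  · refine Integrable.mono' ((integrableOn_exp_mul_Ioi (a := -z.re) (by linarith) 0).const_mul C)
      (hmeas z).aestronglyMeasurable ?_
    refine (ae_restrict_iff' measurableSet_Ioi).mpr (Eventually.of_forall fun u hu => ?_)
    rw [norm_mul, Complex.norm_exp, hre, neg_mul]
    exact mul_le_mul_of_nonneg_right (hC u hu) (Real.exp_pos _).le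
  · exact Measurable.aestronglyMeasurable (by fun_prop)
  · refine (ae_restrict_iff' measurableSet_Ioi).mpr (Eventually.of_forall fun u hu w hw => ?_)
    have hu0 : 0 < u := hu
    have hw' : z.re / 2 ≤ w.re := by
      have := (Complex.abs_re_le_norm (w - z)).trans (mem_ball_iff_norm.mp hw).le
      rw [Complex.sub_re, abs_le] at this
      linarith [this.1]
    rw [norm_mul, norm_mul, Complex.norm_exp, hre, norm_neg, one_mul, Complex.norm_real,
      Real.norm_of_nonneg hu0.le, Real.rpow_one, mul_comm u]
    gcongr
    · exact hC u hu
    · nlinarith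
  · exact (integrableOn_rpow_mul_exp_neg_mul_rpow (by norm_num) one_pos hε).const_mul C
  · refine Eventually.of_forall fun u w _ => ?_
    exact ((((hasDerivAt_id w).mul_const (u : ℂ)).neg).cexp).const_mul (f u)

lemma integral_Ioi_one_mul_cpow (S : ℝ → ℂ) (z : ℂ) :
    ∫ t in Set.Ioi (1 : ℝ), S t * (t : ℂ) ^ (-(1 / 2 + z + 1)) =
      ∫ u in Set.Ioi (0 : ℝ), S (Real.exp u) * Real.exp (-(u / 2)) * Complex.exp (-(z * u)) := by
  have himg : Real.exp '' Set.Ioi 0 = Set.Ioi 1 := by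
    ext t
    refine ⟨?_, fun ht => ⟨Real.log t, Real.log_pos ht, Real.exp_log (one_pos.trans ht)⟩⟩
    rintro ⟨u, hu, rfl⟩
    exact Real.one_lt_exp_iff.mpr hu
  rw [← himg, integral_image_eq_integral_abs_deriv_smul measurableSet_Ioi
    (fun u _ => (Real.hasDerivAt_exp u).hasDerivWithinAt) Real.exp_injective.injOn]
  refine setIntegral_congr_fun measurableSet_Ioi fun u _ => ?_
  simp only [abs_of_pos (Real.exp_pos u), Complex.real_smul]
  rw [Complex.cpow_def_of_ne_zero (by exact_mod_cast (Real.exp_pos u).ne'),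
    ← Complex.ofReal_log (Real.exp_pos u).le, Real.log_exp, mul_left_comm, mul_assoc]
  push_cast
  rw [← Complex.exp_add, ← Complex.exp_add]
  congr 2
  ring

section TwistedPsi

variable {N : ℕ} {χ : DirichletCharacter ℂ N}

/-- The twisted Chebyshev function `ψ(t, χ) = ∑_{n ≤ t} χ(n) Λ(n)`. -/
noncomputable def twistedPsi (χ : DirichletCharacter ℂ N) (t : ℝ) : ℂ :=
  ∑ k ∈ Finset.Icc 1 ⌊t⌋₊, χ k * (ArithmeticFunction.vonMangoldt k : ℂ)

lemma measurable_twistedPsi : Measurable (twistedPsi χ) :=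
  (measurable_from_nat (f := fun n : ℕ =>
    ∑ k ∈ Finset.Icc 1 n, χ k * (ArithmeticFunction.vonMangoldt k : ℂ))).comp Nat.measurable_floor

lemma norm_twistedPsi_exp_mul_le {C : ℝ} (hC : ∀ t ≥ 1, ‖twistedPsi χ t‖ ≤ C * √t) {u : ℝ}
    (hu : 0 < u) : ‖twistedPsi χ (Real.exp u) * Real.exp (-(u / 2))‖ ≤ C := by
  rw [norm_mul, Complex.norm_real, Real.norm_of_nonneg (Real.exp_pos _).le]
  calc _ ≤ C * √(Real.exp u) * Real.exp (-(u / 2)) :=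
        mul_le_mul_of_nonneg_right (hC _ (Real.one_le_exp hu.le)) (Real.exp_pos _).le
    _ = C := by
        rw [← Real.exp_half, mul_assoc, ← Real.exp_add, add_neg_cancel, Real.exp_zero, mul_one]

variable [NeZero N]

lemma neg_deriv_LFunction_eq {C : ℝ} (hC : ∀ t ≥ 1, ‖twistedPsi χ t‖ ≤ C * √t) (hχ : χ ≠ 1)
    {z : ℂ} (hz : 0 < z.re) :
    -deriv (DirichletCharacter.LFunction χ) (1 / 2 + z) =
      DirichletCharacter.LFunction χ (1 / 2 + z) * ((1 / 2 + z) *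
        ∫ u in Set.Ioi (0 : ℝ), twistedPsi χ (Real.exp u) * Real.exp (-(u / 2)) *
          Complex.exp (-(z * u))) := by
  set f : ℝ → ℂ := fun u => twistedPsi χ (Real.exp u) * Real.exp (-(u / 2))
  have hfm : Measurable f := (measurable_twistedPsi.comp Real.measurable_exp).mul (by fun_prop)
  have hfC : ∀ u > 0, ‖f u‖ ≤ C := fun u hu => norm_twistedPsi_exp_mul_le hC hu
  have hL : Differentiable ℂ (DirichletCharacter.LFunction χ) :=
    DirichletCharacter.differentiable_LFunction hχ
  have hL' : Differentiable ℂ (deriv (DirichletCharacter.LFunction χ)) :=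
    (hL.contDiff (n := 2)).differentiable_deriv_two
  have hopen : IsOpen {z : ℂ | 0 < z.re} := isOpen_lt continuous_const Complex.continuous_re
  have hpre : IsPreconnected {z : ℂ | 0 < z.re} := (convex_halfSpace_re_gt 0).isPreconnected
  have hlin : Differentiable ℂ fun z : ℂ => 1 / 2 + z := by fun_prop
  refine AnalyticOnNhd.eqOn_of_preconnected_of_eventuallyEq (𝕜 := ℂ) (z₀ := 1)
    (f := fun z => -deriv (DirichletCharacter.LFunction χ) (1 / 2 + z))
    (g := fun z => DirichletCharacter.LFunction χ (1 / 2 + z) * ((1 / 2 + z) *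
        ∫ u in Set.Ioi (0 : ℝ), f u * Complex.exp (-(z * u))))
    (DifferentiableOn.analyticOnNhd ((hL'.comp hlin).neg.differentiableOn) hopen)
    (DifferentiableOn.analyticOnNhd (fun w hw => DifferentiableAt.differentiableWithinAt ?_) hopen)
    hpre (by simp) ?_ hz
  · exact ((hL.comp hlin) w).mul ((hlin w).mul (differentiableAt_laplace hfm hfC hw))
  have hmem : {z : ℂ | 1 / 2 < z.re} ∈ 𝓝 (1 : ℂ) :=
    (isOpen_lt continuous_const Complex.continuous_re).mem_nhds (by norm_num)
  filter_upwards [hmem] with w hw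
  have hw' : 1 / 2 < w.re := hw
  have hre : 1 < (1 / 2 + w).re := by
    rw [Complex.add_re]; norm_num; linarith
  have hO : (fun n : ℕ => ∑ k ∈ Finset.Icc 1 n, ((fun n : ℕ => χ n) *
      fun n : ℕ => (ArithmeticFunction.vonMangoldt n : ℂ)) k) =O[atTop]
      fun n : ℕ => (n : ℝ) ^ (1 / 2 : ℝ) := by
    refine Asymptotics.IsBigO.of_bound C ?_
    filter_upwards [eventually_ge_atTop 1] with n hn
    have := hC n (by exact_mod_cast hn)
    rw [twistedPsi, Nat.floor_natCast] at this
    rwa [← Real.sqrt_eq_rpow, Real.norm_of_nonneg (Real.sqrt_nonneg _)]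
  have h1 := LSeries_eq_mul_integral _ (by norm_num) (by linarith)
    (DirichletCharacter.LSeriesSummable_twist_vonMangoldt χ hre) hO
  rw [DirichletCharacter.LSeries_twist_vonMangoldt_eq χ hre,
    ← DirichletCharacter.deriv_LFunction_eq_deriv_LSeries χ hre,
    ← DirichletCharacter.LFunction_eq_LSeries χ hre, div_eq_iff
      (DirichletCharacter.LFunction_ne_zero_of_one_le_re χ (Or.inl hχ) hre.le)] at h1
  rw [h1, mul_comm]
  congr 2
  exact integral_Ioi_one_mul_cpow (twistedPsi χ) w

end TwistedPsi

section Oscillation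

open DirichletCharacter

variable {N : ℕ} {χ : DirichletCharacter ℂ N}

lemma archimedeanTerm_arg_eq (t : ℝ) :
    (3 / 4 + (t * I) / 2 : ℂ) = ((3 / 4 : ℝ) : ℂ) + ((t / 2 : ℝ) : ℂ) * I := by
  push_cast
  ring

lemma re_archimedeanTerm_mul_I (N : ℕ) (t : ℝ) : (archimedeanTerm N (t * I)).re =
    (Real.log N / 2 - Real.log π / 2) +
      (digamma (((3 / 4 : ℝ) : ℂ) + ((t / 2 : ℝ) : ℂ) * I)).re / 2 := by
  rw [archimedeanTerm, archimedeanTerm_arg_eq, Complex.add_re, Complex.ofReal_re,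
    Complex.div_ofNat_re]

lemma continuousAt_archimedeanTerm (N : ℕ) {z : ℂ} (hz : 0 ≤ z.re) :
    ContinuousAt (archimedeanTerm N) z := by
  have h : 0 < (3 / 4 + z / 2).re := by
    rw [Complex.add_re, Complex.div_ofNat_re]
    norm_num
    linarith
  have hd := continuousAt_digamma_of_re_pos h
  have hl : ContinuousAt (fun w : ℂ => 3 / 4 + w / 2) z := by fun_prop
  exact continuousAt_const.add
    ((ContinuousAt.comp (f := fun w : ℂ => 3 / 4 + w / 2) hd hl).div_const 2)

/-- The twisted Chebyshev function of a real odd primitive character is not `O(√t)`. -/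
theorem not_forall_norm_twistedPsi_le [NeZero N] (hodd : χ.Odd) (hprim : χ.IsPrimitive)
    (hreal : χ⁻¹ = χ) (C : ℝ) : ¬ ∀ t ≥ 1, ‖twistedPsi χ t‖ ≤ C * √t := by
  intro hC
  have hC0 : 0 ≤ C := by simpa using (norm_nonneg _).trans (hC 1 le_rfl)
  obtain ⟨φ, M, hM, hφc, hφeven, hφ0, hφ1, hφ, hφs, htest⟩ := exists_test_functions
  set p : ℝ → ℝ := fun t => (archimedeanTerm N (t * I)).re with hp_def
  have hPc : Continuous fun t : ℝ => archimedeanTerm N (t * I) :=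
    continuous_iff_continuousAt.mpr fun t =>
      ContinuousAt.comp (f := fun t : ℝ => (t * I : ℂ))
        (continuousAt_archimedeanTerm N (by simp)) (by fun_prop)
  have hp : Continuous p := Complex.continuous_re.comp hPc
  have hB : ∀ t, -(-((Real.log N / 2 - Real.log π / 2) +
      (digamma ((3 / 4 : ℝ) : ℂ)).re / 2)) ≤ p t := fun t => by
    have := re_digamma_ofReal_le (σ := 3 / 4) (by norm_num) (t / 2)
    simp only [hp_def, re_archimedeanTerm_mul_I]
    linarith
  have htop : ∀ A, ∃ t₀, ∀ t, t₀ ≤ |t| → A ≤ p t := fun A => by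
    obtain ⟨t₀, ht₀⟩ := exists_forall_le_re_digamma (σ := 3 / 4) (by norm_num)
      (2 * (A - (Real.log N / 2 - Real.log π / 2)))
    refine ⟨2 * t₀, fun t ht => ?_⟩
    have := ht₀ (t / 2) (by rw [abs_div, abs_two]; linarith)
    simp only [hp_def, re_archimedeanTerm_mul_I]
    linarith
  obtain ⟨T, hT, hlt⟩ := exists_lt_integral_mul_dilate hφc hφ0 hφ1 hφ hφs hp hB htop (2 * (C * M))
  have hT0 : 0 < T := one_pos.trans_le hT
  obtain ⟨g, k, hg, hk, hkM⟩ := htest T hT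
  have hgT : ∀ t, T < |t| → g t = 0 := fun t ht => by
    rw [hg, hφs, Complex.ofReal_zero]
    rw [abs_div, abs_of_pos hT0, one_le_div hT0]
    exact ht.le
  obtain ⟨n, γ, q, δ₀, hδ₀, hq, hD⟩ := exists_logDeriv_eq_sum_add
    (differentiable_centeredXi hodd.ne_one) (exists_centeredXi_ne_zero hodd) T
  have hmain := norm_integral_mul_le_of_odd
    (f := fun u => twistedPsi χ (Real.exp u) * Real.exp (-(u / 2))) (C := C)
    ((measurable_twistedPsi.comp Real.measurable_exp).mul (by fun_prop))
    (fun u hu => norm_twistedPsi_exp_mul_le hC hu)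
    γ (q := q) (D := logDeriv (centeredXi χ)) (P := archimedeanTerm N) hδ₀ hq
    (fun z hz hz0 => (hD z hz hz0).2) (logDeriv_centeredXi_neg hodd hprim hreal)
    (fun z hz => (continuousAt_archimedeanTerm N hz.1.1).continuousWithinAt)
    (fun z hz => ?_) g k (fun t => by rw [hg, hg, neg_div, hφeven]) hgT hk
  · have hint : Integrable fun t : ℝ => archimedeanTerm N (t * I) * g t := by
      refine (hPc.mul g.continuous).integrable_of_hasCompactSupport ?_
      refine HasCompactSupport.intro (isCompact_Icc (a := -T) (b := T)) fun t ht => ?_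
      rw [Pi.mul_apply, hgT t (by rw [Set.mem_Icc, ← abs_le, not_le] at ht; exact ht), mul_zero]
    have hre : ∫ t, p t * φ (t / T) = (∫ t : ℝ, archimedeanTerm N (t * I) * g t).re := by
      have := integral_re hint
      simp only [RCLike.re_to_complex] at this
      rw [← this]
      refine integral_congr_ae (Eventually.of_forall fun t => ?_)
      simp only [hg, Complex.re_mul_ofReal, hp_def]
    have h1 := (Complex.re_le_norm _).trans hmain
    rw [← hre] at h1
    have h2 : C * ∫ u, ‖angularFourier k u‖ ≤ C * (M * T) := mul_le_mul_of_nonneg_left hkM hC0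
    linarith
  · have hz0 : 0 < z.re := hz.1.1
    have hne := (hD z ⟨⟨by linarith, hz.1.2⟩, hz.2⟩ hz0.ne').1
    have h1 := neg_deriv_LFunction_eq hC hodd.ne_one hz0
    have hL : LFunction χ (1 / 2 + z) ≠ 0 := by
      intro h0
      refine hne (mul_eq_zero_of_right _ ?_)
      rw [completedLFunction_eq_mul_gammaFactor hodd, h0, mul_zero]
      rw [Complex.add_re]
      norm_num
      linarith
    rw [logDeriv_centeredXi hodd hz0 hne, logDeriv_apply, sub_add_cancel_left, ← neg_div, h1,
      mul_div_cancel_left₀ _ hL]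

end Oscillation

/-- The nontrivial Dirichlet character modulo `4`, with complex values. -/
noncomputable def chiFour : DirichletCharacter ℂ 4 := ZMod.χ₄.ringHomComp (Int.castRingHom ℂ)

lemma chiFour_odd : chiFour.Odd := by
  have h : ZMod.χ₄ (-1) = -1 := by decide
  rw [DirichletCharacter.Odd, chiFour, MulChar.ringHomComp_apply, h]
  simp

lemma chiFour_isPrimitive : chiFour.IsPrimitive := by
  have hdvd := chiFour.conductor_dvd_level
  have h1 : chiFour.conductor ≠ 1 := fun h =>
    chiFour_odd.ne_one (DirichletCharacter.eq_one_iff_conductor_eq_one.mpr h)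
  have h2 : chiFour.conductor ≠ 2 := fun h => by
    have hf := chiFour.factorsThrough_conductor
    rw [h] at hf
    obtain ⟨hd, χ₀, hχ₀⟩ := hf
    have : χ₀ = 1 := by
      ext a
      rw [Subsingleton.elim a 1]
      simp
    exact chiFour_odd.ne_one (by rw [hχ₀, this, DirichletCharacter.changeLevel_one])
  have hle : chiFour.conductor ≤ 4 := Nat.le_of_dvd (by norm_num) hdvd
  rw [DirichletCharacter.isPrimitive_def]
  interval_cases chiFour.conductor <;> omega

lemma chiFour_inv : chiFour⁻¹ = chiFour := (ZMod.isQuadratic_χ₄.comp _).inv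

lemma abs_χ₄_le_one (n : ℕ) : |(ZMod.χ₄ n : ℝ)| ≤ 1 := by
  rcases ZMod.isQuadratic_χ₄ n with h | h | h <;> simp [h]

lemma twistedPsi_chiFour (x : ℝ) : twistedPsi chiFour x =
    ((∑ n ∈ Finset.range (⌊x⌋₊ + 1),
      (ZMod.χ₄ n : ℝ) * ArithmeticFunction.vonMangoldt n : ℝ) : ℂ) := by
  rw [Finset.sum_range_succ', twistedPsi, Finset.range_eq_Ico,
    Finset.sum_Ico_add' (fun n : ℕ => (ZMod.χ₄ n : ℝ) * ArithmeticFunction.vonMangoldt n)]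
  simp [chiFour, Finset.Ico_add_one_right_eq_Icc]

lemma abs_sum_χ₄_mul_vonMangoldt_le (x : ℝ) :
    |∑ n ∈ Finset.range (⌊x⌋₊ + 1), (ZMod.χ₄ n : ℝ) * ArithmeticFunction.vonMangoldt n| ≤
      Chebyshev.psi x := by
  rw [Chebyshev.psi_eq_sum_Icc, ← Nat.range_succ_eq_Icc_zero]
  refine (Finset.abs_sum_le_sum_abs _ _).trans (Finset.sum_le_sum fun n _ => ?_)
  rw [abs_mul, abs_of_nonneg (ArithmeticFunction.vonMangoldt_nonneg (n := n))]
  exact mul_le_of_le_one_left ArithmeticFunction.vonMangoldt_nonneg (abs_χ₄_le_one n)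

lemma abs_sum_χ₄_mul_vonMangoldt_sub_le (x : ℝ) :
    |∑ n ∈ Finset.range (⌊x⌋₊ + 1), (ZMod.χ₄ n : ℝ) * ArithmeticFunction.vonMangoldt n -
      ∑ n ∈ Finset.range (⌊x⌋₊ + 1), (ZMod.χ₄ n : ℝ) * (if n.Prime then Real.log n else 0)| ≤
      Chebyshev.psi x - Chebyshev.theta x := by
  rw [Chebyshev.psi_eq_sum_Icc, Chebyshev.theta_eq_sum_Icc, ← Nat.range_succ_eq_Icc_zero,
    Finset.sum_filter, ← Finset.sum_sub_distrib, ← Finset.sum_sub_distrib]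
  refine (Finset.abs_sum_le_sum_abs _ _).trans (Finset.sum_le_sum fun n _ => ?_)
  have h : (0 : ℝ) ≤ ArithmeticFunction.vonMangoldt n - if n.Prime then Real.log n else 0 := by
    split_ifs with hp
    · rw [ArithmeticFunction.vonMangoldt_apply_prime hp, sub_self]
    · rw [sub_zero]
      exact ArithmeticFunction.vonMangoldt_nonneg
  rw [← mul_sub, abs_mul, abs_of_nonneg h]
  exact mul_le_of_le_one_left h (abs_χ₄_le_one n)

lemma exists_ge_mul_sqrt_lt_abs_sum_χ₄ (C X : ℝ) : ∃ x ≥ X, C * √x <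
    |∑ n ∈ Finset.range (⌊x⌋₊ + 1), (ZMod.χ₄ n : ℝ) * ArithmeticFunction.vonMangoldt n| := by
  have h := not_forall_norm_twistedPsi_le chiFour_odd chiFour_isPrimitive chiFour_inv
    (max C (Chebyshev.psi X))
  push Not at h
  obtain ⟨t, ht1, ht⟩ := h
  rw [twistedPsi_chiFour, Complex.norm_real, Real.norm_eq_abs] at ht
  have hsqrt : 1 ≤ √t := Real.one_le_sqrt.mpr ht1
  refine ⟨t, ?_, lt_of_le_of_lt
    (mul_le_mul_of_nonneg_right (le_max_left _ _) (Real.sqrt_nonneg _)) ht⟩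
  by_contra! htX
  have h1 := (abs_sum_χ₄_mul_vonMangoldt_le t).trans (Chebyshev.psi_mono htX.le)
  have h2 : Chebyshev.psi X ≤ max C (Chebyshev.psi X) * √t :=
    (le_max_right _ _).trans (le_mul_of_one_le_right
      ((Chebyshev.psi_nonneg X).trans (le_max_right _ _)) hsqrt)
  linarith

lemma sum_range_four_mul_χ₄ (m : ℕ) : ∑ a ∈ Finset.range (4 * m), (ZMod.χ₄ a : ℝ) = 0 := by
  induction m with
  | zero => simp
  | succ m ih =>
    have h (r : ℕ) : ZMod.χ₄ ((4 * m + r : ℕ) : ZMod 4) = ZMod.χ₄ (r : ZMod 4) := by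
      rw [ZMod.χ₄_nat_mod_four, Nat.mul_add_mod, ← ZMod.χ₄_nat_mod_four]
    have h0 := h 0
    have hv : ZMod.χ₄ (0 : ZMod 4) = 0 ∧ ZMod.χ₄ (1 : ZMod 4) = 1 ∧ ZMod.χ₄ (2 : ZMod 4) = 0 ∧
      ZMod.χ₄ (3 : ZMod 4) = -1 := by decide
    rw [add_zero] at h0
    rw [show 4 * (m + 1) = 4 * m + 1 + 1 + 1 + 1 by ring, Finset.sum_range_succ,
      Finset.sum_range_succ, Finset.sum_range_succ, Finset.sum_range_succ, ih, h0,
      add_assoc (4 * m) 1 1, add_assoc (4 * m) _ 1, h, h, h]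
    simp [hv]

/-- Cauchy–Schwarz lower bound for the variance over reduced residue classes. -/
lemma sq_sum_χ₄_mul_le {q : ℕ} (hq : q ≠ 0) (h4 : 4 ∣ q)
    (hcop : ∀ a : ℕ, a.Coprime 4 → a.Coprime q) (S : Finset ℕ) (b : ℕ → ℝ) (c : ℝ) :
    (∑ n ∈ S, (ZMod.χ₄ n : ℝ) * b n) ^ 2 ≤ q.totient *
      ∑ a ∈ (Finset.range q).filter (fun a => Nat.Coprime a q),
        (∑ n ∈ S.filter (fun n => n % q = a), b n - c) ^ 2 := by
  have hsupp (a : ℕ) (ha : (ZMod.χ₄ a : ℝ) ≠ 0) : a.Coprime q := by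
    refine hcop a (by_contra fun h => ha ?_)
    rw [MulChar.map_nonunit _ (fun hu => h ((ZMod.isUnit_iff_coprime a 4).mp hu)), Int.cast_zero]
  have hsum : ∑ a ∈ (Finset.range q).filter (fun a => Nat.Coprime a q),
      (ZMod.χ₄ a : ℝ) * (∑ n ∈ S.filter (fun n => n % q = a), b n - c) =
        ∑ n ∈ S, (ZMod.χ₄ n : ℝ) * b n := by
    rw [Finset.sum_filter_of_ne fun a _ ha => hsupp a (left_ne_zero_of_mul ha)]
    simp only [mul_sub, Finset.sum_sub_distrib, ← Finset.sum_mul]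
    obtain ⟨m, rfl⟩ := h4
    rw [sum_range_four_mul_χ₄, zero_mul, sub_zero,
      ← Finset.sum_fiberwise_of_maps_to (s := S) (g := fun n => n % (4 * m))
        (t := Finset.range (4 * m))
        (fun n _ => Finset.mem_range.mpr (Nat.mod_lt _ (Nat.pos_of_ne_zero hq)))]
    refine Finset.sum_congr rfl fun a _ => ?_
    rw [Finset.mul_sum]
    refine Finset.sum_congr rfl fun n hn => ?_
    rw [← (Finset.mem_filter.mp hn).2, ZMod.χ₄_nat_mod_four (n % (4 * m)),
      Nat.mod_mul_right_mod, ← ZMod.χ₄_nat_mod_four]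
  rw [← hsum]
  refine (Finset.sum_mul_sq_le_sq_mul_sq _ _ _).trans ?_
  refine mul_le_mul_of_nonneg_right ?_ (Finset.sum_nonneg fun a _ => sq_nonneg _)
  calc ∑ a ∈ (Finset.range q).filter (fun a => Nat.Coprime a q), (ZMod.χ₄ a : ℝ) ^ 2
      ≤ ∑ a ∈ (Finset.range q).filter (fun a => Nat.Coprime a q), (1 : ℝ) :=
        Finset.sum_le_sum fun a _ => by
          rw [← sq_abs]; exact pow_le_one₀ (abs_nonneg _) (abs_χ₄_le_one a)
    _ = q.totient := by
        simp only [Finset.sum_const, nsmul_eq_mul, mul_one, Nat.totient_eq_card_coprime,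
          Nat.coprime_comm]

lemma sq_sum_χ₄_mul_vonMangoldt_le_Vvar {q : ℕ} (hq : q ≠ 0) (h4 : 4 ∣ q)
    (hcop : ∀ a : ℕ, a.Coprime 4 → a.Coprime q) (x : ℝ) :
    (∑ n ∈ Finset.range (⌊x⌋₊ + 1), (ZMod.χ₄ n : ℝ) * ArithmeticFunction.vonMangoldt n) ^ 2 ≤
      q.totient * Vvar x q :=
  sq_sum_χ₄_mul_le hq h4 hcop _ _ _

lemma sq_sum_χ₄_mul_log_le_Gvar {q : ℕ} (hq : q ≠ 0) (h4 : 4 ∣ q)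
    (hcop : ∀ a : ℕ, a.Coprime 4 → a.Coprime q) (x : ℝ) :
    (∑ n ∈ Finset.range (⌊x⌋₊ + 1), (ZMod.χ₄ n : ℝ) * (if n.Prime then Real.log n else 0)) ^ 2 ≤
      q.totient * Gvar x q := by
  refine (sq_sum_χ₄_mul_le hq h4 hcop _ _ (x / q.totient)).trans_eq ?_
  simp only [Gvar, thetaQA, ← Finset.sum_filter, Finset.filter_filter, and_comm]

/-- If `(q * (k + 1) * √x) ^ 2 ≤ φ(q) * V` then `V / (x log q)` is at least `k`. -/
lemma le_div_of_sq_le_totient_mul {q : ℕ} (hq : 1 < q) {x V k : ℝ} (hx : 0 < x) (hk : 0 ≤ k)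
    (h : (q * (k + 1) * √x) ^ 2 ≤ q.totient * V) : k ≤ V / (x * Real.log q) := by
  have hq' : (1 : ℝ) < q := by exact_mod_cast hq
  have hφ : (0 : ℝ) < q.totient := by exact_mod_cast Nat.totient_pos.mpr (by omega)
  have hφq : (q.totient : ℝ) ≤ q := by exact_mod_cast Nat.totient_le q
  have hlog : Real.log q ≤ q := (Real.log_le_self (by linarith))
  rw [le_div_iff₀ (mul_pos hx (Real.log_pos hq'))]
  refine le_of_mul_le_mul_left ?_ hφ
  refine le_trans ?_ h
  rw [mul_pow, Real.sq_sqrt hx.le, mul_pow]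
  calc q.totient * (k * (x * Real.log q)) = (q.totient * Real.log q) * k * x := by ring
    _ ≤ (q * q) * (k + 1) ^ 2 * x := by
        have := Real.log_nonneg hq'.le
        gcongr
        nlinarith
    _ = _ := by ring

theorem hooley_conjecture_false :
    ∃ (q : ℕ → ℕ) (x : ℕ → ℝ),
      (∀ j, 0 < q j ∧ (q j : ℝ) < x j) ∧
      Tendsto (fun j => q j) atTop atTop ∧
      Tendsto x atTop atTop ∧
      Tendsto (fun j => Gvar (x j) (q j) / (x j * Real.log (q j))) atTop atTop ∧
      Tendsto (fun j => Vvar (x j) (q j) / (x j * Real.log (q j))) atTop atTop := by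
  obtain ⟨K, hK⟩ := Chebyshev.psi_sub_theta_le_mul_sqrt
  choose x hxge hx using fun j : ℕ => exists_ge_mul_sqrt_lt_abs_sum_χ₄
    (|K| + (4 ^ (j + 1) : ℕ) * (j + 1)) ((4 ^ (j + 1) : ℕ) + (j + 1))
  have hj4 (j : ℕ) : j ≤ 4 ^ (j + 1) :=
    (Nat.lt_pow_self (by norm_num)).le.trans (Nat.pow_le_pow_right (by norm_num) j.le_succ)
  have hq1 (j : ℕ) : 1 < 4 ^ (j + 1) := Nat.one_lt_pow j.succ_ne_zero (by norm_num)
  have hqx (j : ℕ) : ((4 ^ (j + 1) : ℕ) : ℝ) + (j + 1) ≤ x j := hxge j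
  have hx0 (j : ℕ) : 0 < x j := lt_of_lt_of_le (by positivity) (hqx j)
  have hdvd (j : ℕ) : 4 ∣ 4 ^ (j + 1) := dvd_pow_self 4 j.succ_ne_zero
  have hcop (j a : ℕ) (ha : a.Coprime 4) : a.Coprime (4 ^ (j + 1)) := ha.pow_right _
  refine ⟨fun j => 4 ^ (j + 1), x, fun j => ⟨by positivity, ?_⟩,
    tendsto_atTop_mono hj4 tendsto_id,
    tendsto_atTop_mono (fun j => ?_) tendsto_natCast_atTop_atTop,
    tendsto_atTop_mono (fun j => ?_) tendsto_natCast_atTop_atTop,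
    tendsto_atTop_mono (fun j => ?_) tendsto_natCast_atTop_atTop⟩
  · have := hqx j
    have : (0 : ℝ) ≤ j := j.cast_nonneg
    linarith
  · have := hqx j
    have : (0 : ℝ) ≤ (4 ^ (j + 1) : ℕ) := Nat.cast_nonneg _
    linarith
  · refine le_div_of_sq_le_totient_mul (hq1 j) (hx0 j) j.cast_nonneg (le_trans ?_
      (sq_sum_χ₄_mul_log_le_Gvar (by positivity) (hdvd j) (hcop j) (x j)))
    have h1 := abs_sum_χ₄_mul_vonMangoldt_sub_le (x j)
    have h2 := hK (x j)
    have h3 := mul_le_mul_of_nonneg_right (le_abs_self K) (Real.sqrt_nonneg (x j))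
    have h4 := hx j
    have h5 := (abs_sub_abs_le_abs_sub _ _).trans (h1.trans h2)
    rw [add_mul] at h4
    exact sq_le_sq.mpr (by rw [abs_of_nonneg (by positivity)]; linarith)
  · refine le_div_of_sq_le_totient_mul (hq1 j) (hx0 j) j.cast_nonneg (le_trans ?_
      (sq_sum_χ₄_mul_vonMangoldt_le_Vvar (by positivity) (hdvd j) (hcop j) (x j)))
    have h3 := mul_nonneg (abs_nonneg K) (Real.sqrt_nonneg (x j))
    have h4 := hx j
    rw [add_mul] at h4
    exact sq_le_sq.mpr (by rw [abs_of_nonneg (by positivity)]; linarith)
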